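/- arXiv:1310.7785 — 2 statements merged into one kernel-verified Lean document; each statement's English description precedes it below -/
import Mathlib

section
/- Assume the Trudinger–Moser property holds with some constant ω ∈ (0,π] and that f satisfies hypotheses (H') with critical exponent α₀ ∈ (0, 2πω). Then the functional φ satisfies the Palais–Smale condition at every level c < ω/(2α₀). -/
open MeasureTheory Real Set Filter Topology

noncomputable section

/-- Integrand of the squared Gagliardo `H^{1/2}` seminorm on `ℝ`. -/
def gagKer (u : ℝ → ℝ) : ℝ × ℝ → ℝ :=
  fun p => (u p.1 - u p.2) ^ 2 / |p.1 - p.2| ^ 2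

/-- Integrand of the Gagliardo inner product `⟨u,v⟩_X`. -/
def innerKer (u v : ℝ → ℝ) : ℝ × ℝ → ℝ :=
  fun p => (u p.1 - u p.2) * (v p.1 - v p.2) / |p.1 - p.2| ^ 2

/-- `u ∈ H^{1/2}(ℝ)` : `u ∈ L²(ℝ)` with finite Gagliardo seminorm. -/
def memH (u : ℝ → ℝ) : Prop :=
  Measurable u ∧ Integrable (fun x => (u x) ^ 2) ∧ Integrable (gagKer u)

/-- Squared Gagliardo seminorm `[u]²`. -/
def gagSq (u : ℝ → ℝ) : ℝ := ∫ p : ℝ × ℝ, gagKer u p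

/-- Gagliardo seminorm `[u]`, i.e. the norm `‖u‖_X`. -/
def gagNorm (u : ℝ → ℝ) : ℝ := Real.sqrt (gagSq u)

/-- Inner product `⟨u, v⟩_X`. -/
def innerX (u v : ℝ → ℝ) : ℝ := ∫ p : ℝ × ℝ, innerKer u v p

/-- `u ∈ X` : `u ∈ H^{1/2}(ℝ)` and `u = 0` a.e. outside `(0,1)`. -/
def memX (u : ℝ → ℝ) : Prop :=
  memH u ∧ ∀ᵐ x : ℝ, x ∉ Ioo (0 : ℝ) 1 → u x = 0

/-- `λ₁ = inf {[u]² : u ∈ X, ‖u‖_{L²(0,1)} = 1}`. -/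
def lam1 : ℝ :=
  sInf { t : ℝ | ∃ u : ℝ → ℝ, memX u ∧ (∫ x in Ioo (0 : ℝ) 1, (u x) ^ 2) = 1 ∧ gagSq u = t }

/-- Trudinger–Moser property with constant `ω`. -/
def TMprop (ω : ℝ) : Prop :=
  ∀ α : ℝ, 0 < α → α < 2 * π * ω →
    ∃ K : ℝ, 0 < K ∧ ∀ u : ℝ → ℝ, memX u → gagNorm u ≤ 1 →
      (∫⁻ x in Ioo (0 : ℝ) 1, ENNReal.ofReal (exp (α * (u x) ^ 2))) ≤ ENNReal.ofReal K

/-- The primitive `F(t) = ∫₀ᵗ f(τ) dτ`. -/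
def primF (f : ℝ → ℝ) : ℝ → ℝ := fun t => ∫ τ in (0 : ℝ)..t, f τ

/-- Hypotheses (H). -/
def HypH (f : ℝ → ℝ) : Prop :=
  Continuous f ∧ f 0 = 0 ∧
  (∃ t₀ > (0 : ℝ), ∃ M > (0 : ℝ),
    ∀ t : ℝ, t₀ ≤ |t| → 0 < primF f t ∧ primF f t ≤ M * |f t|) ∧
  (∀ t : ℝ, t ≠ 0 → 0 < 2 * primF f t ∧ 2 * primF f t ≤ f t * t) ∧
  (Filter.limsup (fun t => primF f t / t ^ 2) (𝓝[≠] (0 : ℝ)) < lam1 / (4 * π)) ∧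
  (∀ α : ℝ, 0 < α →
    Filter.Tendsto (fun t => |f t| * exp (-α * t ^ 2)) (Filter.cocompact ℝ) (𝓝 0))

/-- Hypotheses (H') with Trudinger–Moser constant `ω`. -/
def HypH' (f : ℝ → ℝ) (ω : ℝ) : Prop :=
  Continuous f ∧ f 0 = 0 ∧
  (∃ t₀ > (0 : ℝ), ∃ M > (0 : ℝ),
    ∀ t : ℝ, t₀ ≤ |t| → 0 < primF f t ∧ primF f t ≤ M * |f t|) ∧
  (∀ t : ℝ, t ≠ 0 → 0 < 2 * primF f t ∧ 2 * primF f t ≤ f t * t) ∧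
  (Filter.limsup (fun t => primF f t / t ^ 2) (𝓝[≠] (0 : ℝ)) < lam1 / (4 * π)) ∧
  ∃ α₀ : ℝ, 0 < α₀ ∧ α₀ < 2 * π * ω ∧
    (∀ α : ℝ, 0 < α → α < α₀ →
      Filter.Tendsto (fun t => |f t| * exp (-α * t ^ 2)) (Filter.cocompact ℝ) Filter.atTop) ∧
    (∀ α : ℝ, α₀ < α →
      Filter.Tendsto (fun t => |f t| * exp (-α * t ^ 2)) (Filter.cocompact ℝ) (𝓝 0)) ∧
    ∃ ψ : ℝ → ℝ, memX ψ ∧ gagNorm ψ = 1 ∧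
      ∃ b : ℝ, b < ω / (2 * α₀) ∧ ∀ t : ℝ, 0 < t →
        t ^ 2 / (4 * π) - (∫ x in Ioo (0 : ℝ) 1, primF f (t * ψ x)) ≤ b

/-- `u` is a (weak) solution of `(-Δ)^{1/2} u = f(u)` in `(0,1)`, `u = 0` outside. -/
def IsWeakSolution (f u : ℝ → ℝ) : Prop :=
  memX u ∧ ∀ v : ℝ → ℝ, memX v →
    IntegrableOn (fun x => f (u x) * v x) (Ioo (0 : ℝ) 1) ∧
    innerX u v / (2 * π) = ∫ x in Ioo (0 : ℝ) 1, f (u x) * v x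

/-- The energy functional `φ(u) = ‖u‖_X²/(4π) - ∫₀¹ F(u) dx`. -/
def phi (f u : ℝ → ℝ) : ℝ :=
  gagSq u / (4 * π) - ∫ x in Ioo (0 : ℝ) 1, primF f (u x)

/-- `⟨φ'(u), v⟩ = (1/(2π))⟨u,v⟩_X - ∫₀¹ f(u) v dx`. -/
def phiDeriv (f u v : ℝ → ℝ) : ℝ :=
  innerX u v / (2 * π) - ∫ x in Ioo (0 : ℝ) 1, f (u x) * v x

/-- The Palais–Smale condition at level `c`. -/
def PalaisSmaleAt (f : ℝ → ℝ) (c : ℝ) : Prop :=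
  ∀ u : ℕ → ℝ → ℝ, (∀ n, memX (u n)) →
    Filter.Tendsto (fun n => phi f (u n)) Filter.atTop (𝓝 c) →
    (∃ ε : ℕ → ℝ, Filter.Tendsto ε Filter.atTop (𝓝 0) ∧
      ∀ n, ∀ v : ℝ → ℝ, memX v → gagNorm v ≤ 1 → |phiDeriv f (u n) v| ≤ ε n) →
    ∃ w : ℝ → ℝ, memX w ∧ ∃ g : ℕ → ℕ, StrictMono g ∧
      Filter.Tendsto (fun k => gagNorm (fun x => u (g k) x - w x)) Filter.atTop (𝓝 0)



def dq (u : ℝ → ℝ) (p : ℝ × ℝ) : ℝ := (u p.1 - u p.2) / |p.1 - p.2|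

lemma gagKer_eq (u : ℝ → ℝ) : gagKer u = fun p => dq u p ^ 2 := by
  funext p; simp only [gagKer, dq, div_pow]

lemma innerKer_eq (u v : ℝ → ℝ) : innerKer u v = fun p => dq u p * dq v p := by
  funext p; simp only [innerKer, dq]; rw [div_mul_div_comm, sq]

lemma dq_measurable {u : ℝ → ℝ} (hu : Measurable u) : Measurable (dq u) := by
  unfold dq
  fun_prop

lemma dq_sub (u v : ℝ → ℝ) : dq (fun x => u x - v x) = fun p => dq u p - dq v p := by
  funext p; simp only [dq]; ring

lemma dq_smul (a : ℝ) (v : ℝ → ℝ) : dq (fun x => a * v x) = fun p => a * dq v p := by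
  funext p; simp only [dq]; ring

lemma memX_iff (u : ℝ → ℝ) : memX u ↔ Measurable u ∧ MemLp u 2 volume ∧ MemLp (dq u) 2 volume ∧
    ∀ᵐ x : ℝ, x ∉ Ioo (0 : ℝ) 1 → u x = 0 := by
  unfold memX memH
  constructor
  · rintro ⟨⟨h1, h2, h3⟩, h4⟩
    refine ⟨h1, (memLp_two_iff_integrable_sq h1.aestronglyMeasurable).2 h2,
      (memLp_two_iff_integrable_sq (dq_measurable h1).aestronglyMeasurable).2 ?_, h4⟩
    rw [gagKer_eq] at h3; exact h3
  · rintro ⟨h1, h2, h3, h4⟩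
    refine ⟨⟨h1, (memLp_two_iff_integrable_sq h1.aestronglyMeasurable).1 h2, ?_⟩, h4⟩
    rw [gagKer_eq]
    exact (memLp_two_iff_integrable_sq (dq_measurable h1).aestronglyMeasurable).1 h3

lemma memX.meas {u : ℝ → ℝ} (h : memX u) : Measurable u := h.1.1
lemma memX.dq2 {u : ℝ → ℝ} (h : memX u) : MemLp (dq u) 2 volume := ((memX_iff u).1 h).2.2.1

lemma memX.sub {u v : ℝ → ℝ} (hu : memX u) (hv : memX v) : memX (fun x => u x - v x) := by
  rw [memX_iff] at *
  obtain ⟨a1, a2, a3, a4⟩ := hu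
  obtain ⟨b1, b2, b3, b4⟩ := hv
  refine ⟨a1.sub b1, a2.sub b2, ?_, ?_⟩
  · rw [dq_sub]; exact a3.sub b3
  · filter_upwards [a4, b4] with x h1 h2 hx
    rw [h1 hx, h2 hx, sub_zero]

lemma memX.smul {v : ℝ → ℝ} (a : ℝ) (hv : memX v) : memX (fun x => a * v x) := by
  rw [memX_iff] at *
  obtain ⟨b1, b2, b3, b4⟩ := hv
  refine ⟨b1.const_mul a, b2.const_mul a, ?_, ?_⟩
  · rw [dq_smul]; exact b3.const_mul a
  · filter_upwards [b4] with x h2 hx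
    rw [h2 hx, mul_zero]

lemma gagSq_eq (u : ℝ → ℝ) : gagSq u = ∫ p : ℝ × ℝ, dq u p ^ 2 := by
  unfold gagSq; rw [gagKer_eq]

lemma innerX_eq (u v : ℝ → ℝ) : innerX u v = ∫ p : ℝ × ℝ, dq u p * dq v p := by
  unfold innerX; rw [innerKer_eq]

lemma gagSq_nonneg (u : ℝ → ℝ) : 0 ≤ gagSq u := by
  rw [gagSq_eq]; exact integral_nonneg fun p => sq_nonneg _

lemma gagNorm_sq (u : ℝ → ℝ) : gagNorm u ^ 2 = gagSq u := Real.sq_sqrt (gagSq_nonneg u)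

lemma innerX_self (u : ℝ → ℝ) : innerX u u = gagSq u := by
  rw [gagSq_eq, innerX_eq]; simp only [sq]

lemma innerX_int {u v : ℝ → ℝ} (hu : memX u) (hv : memX v) :
    Integrable (fun p => dq u p * dq v p) := hu.dq2.integrable_mul hv.dq2

lemma innerX_comm (u v : ℝ → ℝ) : innerX u v = innerX v u := by
  simp only [innerX_eq, mul_comm]

lemma innerX_sub_right {u v w : ℝ → ℝ} (hu : memX u) (hv : memX v) (hw : memX w) :
    innerX u (fun x => v x - w x) = innerX u v - innerX u w := by
  rw [innerX_eq, innerX_eq, innerX_eq, ← integral_sub (innerX_int hu hv) (innerX_int hu hw), dq_sub]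
  simp only [mul_sub]

lemma innerX_smul_right (a : ℝ) (u v : ℝ → ℝ) :
    innerX u (fun x => a * v x) = a * innerX u v := by
  rw [innerX_eq, innerX_eq, dq_smul, ← integral_const_mul]
  congr 1; funext p; ring

lemma gagSq_smul (a : ℝ) (v : ℝ → ℝ) : gagSq (fun x => a * v x) = a ^ 2 * gagSq v := by
  rw [gagSq_eq, gagSq_eq, dq_smul, ← integral_const_mul]
  congr 1; funext p; ring

lemma gagSq_sub {v w : ℝ → ℝ} (hv : memX v) (hw : memX w) :
    gagSq (fun x => v x - w x) = innerX v (fun x => v x - w x) - innerX w (fun x => v x - w x) := by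
  rw [← innerX_self, innerX_comm v, innerX_comm w,
    innerX_sub_right (hv.sub hw) hv hw]

lemma gagSq_sub' {v w : ℝ → ℝ} (hv : memX v) (hw : memX w) :
    gagSq (fun x => v x - w x) = gagSq v - 2 * innerX w v + gagSq w := by
  rw [gagSq_sub hv hw, innerX_sub_right hv hv hw, innerX_sub_right hw hv hw, innerX_self,
    innerX_self, innerX_comm v w]; ring

/-- scaling of the derivative bound -/
lemma phiDeriv_bound {f u : ℝ → ℝ} {e : ℝ}
    (h : ∀ v : ℝ → ℝ, memX v → gagNorm v ≤ 1 → |phiDeriv f u v| ≤ e) {v : ℝ → ℝ} (hv : memX v) :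
    |phiDeriv f u v| ≤ e * (1 + gagNorm v) := by
  have hN : 0 ≤ gagNorm v := Real.sqrt_nonneg _
  have hN1 : 0 < 1 + gagNorm v := by linarith
  have := h (fun x => (1 + gagNorm v)⁻¹ * v x) (hv.smul _) (by
    unfold gagNorm
    rw [gagSq_smul, Real.sqrt_mul (sq_nonneg _), Real.sqrt_sq (by positivity)]
    change (1 + gagNorm v)⁻¹ * gagNorm v ≤ 1
    rw [inv_mul_le_iff₀ hN1]; linarith)
  have h2 : phiDeriv f u (fun x => (1 + gagNorm v)⁻¹ * v x) = (1 + gagNorm v)⁻¹ * phiDeriv f u v := by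
    unfold phiDeriv
    rw [innerX_smul_right, mul_sub, ← integral_const_mul, mul_div_assoc]
    congr 2; funext x; ring
  rw [h2, abs_mul, abs_of_pos (inv_pos.2 hN1), inv_mul_le_iff₀ hN1] at this
  linarith

/-- generalised dominated convergence -/
lemma gdc {Ω : Type*} [MeasurableSpace Ω] (μ : Measure Ω) (g : ℕ → Ω → ℝ)
    (hg : ∀ n, Measurable (g n))
    (hlim : ∀ᵐ x ∂μ, Tendsto (fun n => g n x) atTop (𝓝 0))
    (hdom : ∀ ε : ℝ, 0 < ε → ∃ D : Ω → ℝ, Integrable D μ ∧ ∃ r : ℕ → Ω → ℝ,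
      (∀ᶠ n in atTop, (∀ x, |g n x| ≤ D x + r n x) ∧ (∀ x, 0 ≤ r n x) ∧
        ∫⁻ x, ENNReal.ofReal (r n x) ∂μ ≤ ENNReal.ofReal ε)) :
    Tendsto (fun n => ∫ x, g n x ∂μ) atTop (𝓝 0) := by
  have key : Tendsto (fun n => ∫⁻ x, ENNReal.ofReal |g n x| ∂μ) atTop (𝓝 0) := by
    rw [ENNReal.tendsto_nhds_zero]
    intro ε hε
    obtain ⟨e, he0, he1, he⟩ : ∃ e : ℝ, 0 < e ∧ ENNReal.ofReal e ≤ ε / 2 ∧ 0 < ε / 2 := by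
      have h2 : 0 < ε / 2 := ENNReal.half_pos hε.ne'
      obtain ⟨q, hq, hq2⟩ := ENNReal.lt_iff_exists_nnreal_btwn.1 h2
      refine ⟨q, by exact_mod_cast hq, ?_, h2⟩
      rw [ENNReal.ofReal_coe_nnreal]; exact hq2.le
    obtain ⟨D, hD, r, hr⟩ := hdom e he0
    have hmin : Tendsto (fun n => ∫⁻ x, min (ENNReal.ofReal |g n x|) (ENNReal.ofReal (D x)) ∂μ) atTop
        (𝓝 (∫⁻ x, 0 ∂μ)) := by
      apply tendsto_lintegral_of_dominated_convergence' (fun x => ENNReal.ofReal (D x))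
      · intro n
        exact ((hg n).norm.ennreal_ofReal.aemeasurable).inf hD.1.aemeasurable.ennreal_ofReal
      · intro n; exact Eventually.of_forall fun x => min_le_right _ _
      · exact hD.lintegral_lt_top.ne
      · filter_upwards [hlim] with x hx
        have : Tendsto (fun n => ENNReal.ofReal |g n x|) atTop (𝓝 0) := by
          have := ENNReal.tendsto_ofReal hx.abs
          simpa using this
        exact tendsto_of_tendsto_of_tendsto_of_le_of_le tendsto_const_nhds this
          (fun _ => zero_le) (fun _ => min_le_left _ _)
    rw [lintegral_zero] at hmin
    filter_upwards [hr, (ENNReal.tendsto_nhds_zero.1 hmin) _ he] with n hn hm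
    obtain ⟨h1, h2, h3⟩ := hn
    calc ∫⁻ x, ENNReal.ofReal |g n x| ∂μ
        ≤ ∫⁻ x, (min (ENNReal.ofReal |g n x|) (ENNReal.ofReal (D x)) + ENNReal.ofReal (r n x)) ∂μ := by
          apply lintegral_mono
          intro x
          rcases le_total (ENNReal.ofReal |g n x|) (ENNReal.ofReal (D x)) with h | h
          · simp only [min_eq_left h]; exact le_self_add
          · simp only [min_eq_right h]
            exact (ENNReal.ofReal_le_ofReal (h1 x)).trans ENNReal.ofReal_add_le
      _ = ∫⁻ x, min (ENNReal.ofReal |g n x|) (ENNReal.ofReal (D x)) ∂μ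
            + ∫⁻ x, ENNReal.ofReal (r n x) ∂μ := by
          apply lintegral_add_left'
          exact ((hg n).norm.ennreal_ofReal.aemeasurable).inf hD.1.aemeasurable.ennreal_ofReal
      _ ≤ ε / 2 + ε / 2 := add_le_add hm (h3.trans he1)
      _ = ε := ENNReal.add_halves ε
  rw [tendsto_zero_iff_norm_tendsto_zero]
  have k2 := (ENNReal.tendsto_toReal (ENNReal.zero_ne_top)).comp key
  simp only [ENNReal.toReal_zero] at k2
  refine squeeze_zero (fun n => norm_nonneg _) (fun n => ?_) k2
  have := norm_integral_le_lintegral_norm (μ := μ) (g n)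
  simp only [Real.norm_eq_abs] at this ⊢
  exact this


lemma memX.comp_lip {u g : ℝ → ℝ} (hu : memX u) (hg : Measurable g) (hg0 : g 0 = 0)
    (hlip : ∀ a b, |g a - g b| ≤ |a - b|) : memX (fun x => g (u x)) := by
  rw [memX_iff] at *
  obtain ⟨b1, b2, b3, b4⟩ := hu
  have hm : Measurable (fun x => g (u x)) := hg.comp b1
  refine ⟨hm, ?_, ?_, ?_⟩
  · refine b2.mono hm.aestronglyMeasurable (Eventually.of_forall fun x => ?_)
    have := hlip (u x) 0
    simpa [hg0] using this
  · refine b3.mono (dq_measurable hm).aestronglyMeasurable (Eventually.of_forall fun p => ?_)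
    simp only [dq, Real.norm_eq_abs, abs_div, abs_abs]
    exact div_le_div_of_nonneg_right (hlip _ _) (abs_nonneg _)
  · filter_upwards [b4] with x h hx
    rw [h hx, hg0]

def trc (k t : ℝ) : ℝ := max (-k) (min k t)

lemma trc_measurable (k : ℝ) : Measurable (trc k) := by
  unfold trc; fun_prop

lemma trc_lip (k a b : ℝ) : |trc k a - trc k b| ≤ |a - b| := by
  unfold trc
  refine (abs_max_sub_max_le_max _ _ _ _).trans ?_
  simp only [sub_self, abs_zero]
  refine max_le (abs_nonneg _) ((abs_min_sub_min_le_max _ _ _ _).trans ?_)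
  simp

lemma trc_zero {k : ℝ} (hk : 0 ≤ k) : trc k 0 = 0 := by
  unfold trc; rw [min_eq_right hk, max_eq_right (by linarith)]

lemma trc_abs_le {k : ℝ} (hk : 0 ≤ k) (t : ℝ) : |trc k t| ≤ k := by
  unfold trc; rw [abs_le]
  exact ⟨le_max_left _ _, max_le (by linarith) (min_le_left _ _)⟩

lemma trc_abs_le' {k : ℝ} (hk : 0 ≤ k) (t : ℝ) : |trc k t| ≤ |t| := by
  have := trc_lip k t 0
  simpa [trc_zero hk] using this

lemma trc_eq {k t : ℝ} (h : |t| ≤ k) : trc k t = t := by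
  rw [abs_le] at h
  unfold trc; rw [min_eq_right h.2, max_eq_right h.1]

lemma memX.trc {u : ℝ → ℝ} (hu : memX u) (k : ℕ) : memX (fun x => trc k (u x)) :=
  hu.comp_lip (trc_measurable _) (trc_zero (Nat.cast_nonneg k)) (trc_lip _)

lemma trc_eventually (t : ℝ) : ∀ᶠ k : ℕ in atTop, trc k t = t := by
  filter_upwards [tendsto_natCast_atTop_atTop.eventually_ge_atTop |t|] with k hk
  exact trc_eq hk

lemma gagSq_trc_tendsto {u : ℝ → ℝ} (hu : memX u) :
    Tendsto (fun k : ℕ => gagSq (fun x => u x - trc k (u x))) atTop (𝓝 0) := by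
  have h0 : ∫ p : ℝ × ℝ, (0 : ℝ) = 0 := by simp
  rw [← h0]
  simp only [gagSq_eq]
  apply tendsto_integral_of_dominated_convergence (fun p => 4 * dq u p ^ 2)
  · intro n
    exact ((dq_measurable (hu.sub (hu.trc n)).meas).pow_const 2).aestronglyMeasurable
  · exact hu.dq2.integrable_sq.const_mul 4
  · intro n
    refine Eventually.of_forall fun p => ?_
    have h1 : |dq (fun x => u x - trc n (u x)) p| ≤ 2 * |dq u p| := by
      rw [dq_sub]
      have : |dq (fun x => trc n (u x)) p| ≤ |dq u p| := by
        simp only [dq, abs_div, abs_abs]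
        exact div_le_div_of_nonneg_right (trc_lip _ _ _) (abs_nonneg _)
      have h2 := abs_sub (dq u p) (dq (fun x => trc n (u x)) p)
      linarith
    rw [Real.norm_eq_abs, abs_pow, ← sq_abs (dq u p)]
    nlinarith [abs_nonneg (dq (fun x => u x - trc n (u x)) p)]
  · refine Eventually.of_forall fun p => ?_
    apply tendsto_const_nhds.congr'
    filter_upwards [trc_eventually (u p.1), trc_eventually (u p.2)] with k h1 h2
    simp [dq, h1, h2]

abbrev mu0 : Measure ℝ := volume.restrict (Ioo (0 : ℝ) 1)

instance : IsFiniteMeasure mu0 := by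
  constructor; simp [mu0]

lemma TM_scaled {ω : ℝ} (hTM : TMprop ω) {α ρ : ℝ} (hα : 0 < α) (hρ : 0 < ρ)
    (h : α * ρ < 2 * π * ω) : ∃ K : ℝ, 0 < K ∧ ∀ u : ℝ → ℝ, memX u → gagSq u ≤ ρ →
      (∫⁻ x, ENNReal.ofReal (exp (α * (u x) ^ 2)) ∂mu0) ≤ ENNReal.ofReal K := by
  obtain ⟨K, hK, hK2⟩ := hTM (α * ρ) (by positivity) h
  refine ⟨K, hK, fun u hu hur => ?_⟩
  have := hK2 (fun x => (√ρ)⁻¹ * u x) (hu.smul _) (by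
    unfold gagNorm
    rw [gagSq_smul, Real.sqrt_le_one, inv_pow, Real.sq_sqrt hρ.le, inv_mul_le_iff₀ hρ]
    linarith)
  refine le_trans (le_of_eq ?_) this
  congr 1; funext x
  congr 2
  rw [mul_pow, inv_pow, Real.sq_sqrt hρ.le]
  field_simp

lemma exp_int {ω : ℝ} (hω : 0 < ω) (hTM : TMprop ω) {u : ℝ → ℝ} (hu : memX u) (α : ℝ) :
    Integrable (fun x => exp (α * u x ^ 2)) mu0 := by
  wlog hα : 0 < α generalizing α
  · refine (integrable_const (1:ℝ)).mono (by have := hu.meas; fun_prop) (Eventually.of_forall fun x => ?_)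
    rw [Real.norm_eq_abs, abs_of_pos (exp_pos _), norm_one]
    exact exp_le_one_iff.2 (mul_nonpos_of_nonpos_of_nonneg (not_lt.1 hα) (sq_nonneg _))
  have hpi := Real.pi_pos
  set ρ : ℝ := π * ω / (2 * α) with hρ
  have hρ0 : 0 < ρ := by positivity
  obtain ⟨K, hK, hK2⟩ := TM_scaled hTM (α := 2 * α) (ρ := ρ) (by positivity) hρ0 (by
    rw [hρ]; field_simp; norm_num)
  obtain ⟨k, hk⟩ := ((gagSq_trc_tendsto hu).eventually_le_const hρ0).exists
  have h3 := hK2 _ (hu.sub (hu.trc k)) hk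
  have hm := hu.meas
  have hm2 := (hu.sub (hu.trc k)).meas
  have h4 : Integrable (fun x => exp (2 * α * (u x - trc k (u x)) ^ 2)) mu0 := by
    refine ⟨((hm2.pow_const 2).const_mul (2 * α)).exp.aestronglyMeasurable, ?_⟩
    rw [hasFiniteIntegral_iff_ofReal (Eventually.of_forall fun x => (exp_pos _).le)]
    exact h3.trans_lt ENNReal.ofReal_lt_top
  refine (h4.const_mul (exp (2 * α * k ^ 2))).mono (by fun_prop) (Eventually.of_forall fun x => ?_)
  rw [Real.norm_eq_abs, abs_of_pos (exp_pos _), Real.norm_eq_abs, abs_of_pos (by positivity), ← exp_add]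
  apply exp_le_exp.2
  have h5 := trc_abs_le (Nat.cast_nonneg k) (u x)
  have h6 : trc k (u x) ^ 2 ≤ (k:ℝ) ^ 2 := by
    rw [← sq_abs]; exact pow_le_pow_left₀ (abs_nonneg _) h5 2
  have h7 : u x ^ 2 ≤ 2 * k ^ 2 + 2 * (u x - trc k (u x)) ^ 2 := by
    nlinarith [sq_nonneg (u x - 2 * trc k (u x))]
  nlinarith

lemma f_bound {f : ℝ → ℝ} (hcont : Continuous f) {α : ℝ} (hα : 0 < α)
    (h : Tendsto (fun t => |f t| * exp (-α * t ^ 2)) (cocompact ℝ) (𝓝 0)) :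
    ∃ C : ℝ, 0 < C ∧ ∀ t, |f t| ≤ C * exp (α * t ^ 2) := by
  have h1 := h.eventually_le_const (zero_lt_one)
  rw [Filter.eventually_iff, mem_cocompact] at h1
  obtain ⟨S, hS, hS2⟩ := h1
  obtain ⟨B, hB⟩ := hS.exists_bound_of_continuousOn hcont.continuousOn
  refine ⟨max B 1, by positivity, fun t => ?_⟩
  have he : 1 ≤ exp (α * t ^ 2) := one_le_exp (by positivity)
  by_cases ht : t ∈ S
  · have := hB t ht
    rw [Real.norm_eq_abs] at this
    calc |f t| ≤ max B 1 * 1 := by rw [mul_one]; exact this.trans (le_max_left _ _)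
      _ ≤ _ := by gcongr
  · have h2 : |f t| * exp (-α * t ^ 2) ≤ 1 := hS2 ht
    rw [neg_mul, exp_neg, ← div_eq_mul_inv, div_le_iff₀ (exp_pos _)] at h2
    refine h2.trans ?_
    gcongr
    exact le_max_right _ _

lemma fuv_int {ω : ℝ} (hω : 0 < ω) (hTM : TMprop ω) {f : ℝ → ℝ} (hcont : Continuous f) {α C : ℝ}
    (hC : ∀ t, |f t| ≤ C * exp (α * t ^ 2)) {u v : ℝ → ℝ} (hu : memX u) (hv : memX v) :
    Integrable (fun x => f (u x) * v x) mu0 := by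
  have hm := hu.meas
  have hm2 := hv.meas
  have hC0 : 0 ≤ C := by
    have := (abs_nonneg _).trans (hC 0)
    simpa using this
  refine (((exp_int hω hTM hu (2 * α)).add (exp_int hω hTM hv 2)).const_mul C).mono
    ((hcont.measurable.comp hm).mul hm2).aestronglyMeasurable (Eventually.of_forall fun x => ?_)
  have e1 : exp (2 * α * u x ^ 2) = exp (α * u x ^ 2) ^ 2 := by
    rw [← exp_nat_mul]; congr 1; push_cast; ring
  have e2 : exp (2 * v x ^ 2) = exp (v x ^ 2) ^ 2 := by
    rw [← exp_nat_mul]; congr 1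
  have e3 : |v x| ≤ exp (v x ^ 2) := by
    have := add_one_le_exp (v x ^ 2)
    rw [← sq_abs] at this ⊢
    nlinarith [sq_nonneg (|v x| - 1)]
  simp only [Pi.add_apply]
  rw [Real.norm_eq_abs, Real.norm_eq_abs, abs_of_nonneg (a := C * _) (by positivity), abs_mul, e1, e2]
  calc |f (u x)| * |v x| ≤ (C * exp (α * u x ^ 2)) * exp (v x ^ 2) := by
        gcongr; exact hC _
    _ ≤ _ := by
      rw [mul_assoc]; gcongr
      nlinarith [sq_nonneg (exp (α * u x ^ 2) - exp (v x ^ 2)), exp_pos (α * u x ^ 2), exp_pos (v x ^ 2)]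


def JJ (N i : ℕ) : Set ℝ := Ico ((i : ℝ) / N) ((i + 1 : ℝ) / N)

lemma JJ_meas (N i : ℕ) : MeasurableSet (JJ N i) := measurableSet_Ico

lemma JJ_vol {N : ℕ} (i : ℕ) : volume (JJ N i) = ENNReal.ofReal (1 / N) := by
  unfold JJ; rw [Real.volume_Ico]; congr 1; ring

lemma JJ_floor {N i : ℕ} (hN : 0 < N) {x : ℝ} (hx : x ∈ JJ N i) : ⌊x * N⌋₊ = i := by
  have hN' : (0 : ℝ) < N := by exact_mod_cast hN
  obtain ⟨h1, h2⟩ := hx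
  rw [div_le_iff₀ hN'] at h1
  rw [lt_div_iff₀ hN'] at h2
  have : (0 : ℝ) ≤ i := Nat.cast_nonneg i
  rw [Nat.floor_eq_iff (by linarith)]
  exact ⟨h1, h2⟩

lemma JJ_disj {N : ℕ} (hN : 0 < N) {i j : ℕ} (hij : i ≠ j) : Disjoint (JJ N i) (JJ N j) := by
  rw [Set.disjoint_left]
  intro x h1 h2
  exact hij ((JJ_floor hN h1).symm.trans (JJ_floor hN h2))

lemma JJ_union {N : ℕ} (hN : 0 < N) : Ico (0 : ℝ) 1 = ⋃ i ∈ Finset.range N, JJ N i := by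
  have hN' : (0 : ℝ) < N := by exact_mod_cast hN
  ext x
  simp only [mem_iUnion, Finset.mem_range, exists_prop]
  constructor
  · rintro ⟨h1, h2⟩
    have h3 : 0 ≤ x * N := by positivity
    refine ⟨⌊x * N⌋₊, ?_, ?_, ?_⟩
    · rw [Nat.floor_lt h3]; nlinarith
    · rw [div_le_iff₀ hN']; exact Nat.floor_le h3
    · rw [lt_div_iff₀ hN']; exact Nat.lt_floor_add_one _
  · rintro ⟨i, hi, h1, h2⟩
    have hi' : (i : ℝ) + 1 ≤ N := by exact_mod_cast hi
    refine ⟨le_trans (by positivity) h1, h2.trans_le ?_⟩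
    rw [div_le_one hN']; exact hi'

lemma lint_mu0 {N : ℕ} (hN : 0 < N) (g : ℝ → ENNReal) :
    ∫⁻ x, g x ∂mu0 = ∑ i ∈ Finset.range N, ∫⁻ x in JJ N i, g x := by
  have : mu0 = volume.restrict (Ico (0 : ℝ) 1) := Measure.restrict_congr_set Ioo_ae_eq_Ico
  rw [this, JJ_union hN, lintegral_biUnion_finset]
  · intro i _ j _ hij; exact JJ_disj hN hij
  · intro i _; exact JJ_meas N i

lemma approx_one {u : ℝ → ℝ} (hu : Measurable u) {N : ℕ} (hN : 0 < N) (i : ℕ) :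
    ∃ c : ℝ, ∫⁻ x in JJ N i, ENNReal.ofReal ((u x - c) ^ 2) ≤
      ENNReal.ofReal (1 / N) * ∫⁻ p in JJ N i ×ˢ JJ N i, ENNReal.ofReal (gagKer u p) := by
  have hN' : (0 : ℝ) < N := by exact_mod_cast hN
  have hh : (0 : ℝ) < 1 / N := by positivity
  have hvol0 : volume (JJ N i) ≠ 0 := by rw [JJ_vol]; simpa using hN.ne'
  have hvolt : volume (JJ N i) ≠ ⊤ := by rw [JJ_vol]; exact ENNReal.ofReal_ne_top
  have hm : Measurable (fun p : ℝ × ℝ => ENNReal.ofReal ((u p.2 - u p.1) ^ 2)) := by fun_prop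
  have hmG : Measurable (fun y => ∫⁻ x in JJ N i, ENNReal.ofReal ((u x - u y) ^ 2)) :=
    hm.lintegral_prod_right'
  obtain ⟨y, hy, hy2⟩ := exists_le_setLAverage hvol0 hvolt hmG.aemeasurable
  refine ⟨u y, hy2.trans ?_⟩
  rw [setLAverage_eq]
  have h1 : ∫⁻ y in JJ N i, ∫⁻ x in JJ N i, ENNReal.ofReal ((u x - u y) ^ 2) =
      ∫⁻ p in JJ N i ×ˢ JJ N i, ENNReal.ofReal ((u p.2 - u p.1) ^ 2) := by
    rw [Measure.volume_eq_prod, setLIntegral_prod _ hm.aemeasurable]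
  have h2 : ∫⁻ p in JJ N i ×ˢ JJ N i, ENNReal.ofReal ((u p.2 - u p.1) ^ 2) ≤
      ∫⁻ p in JJ N i ×ˢ JJ N i, ENNReal.ofReal ((1 / N) ^ 2) * ENNReal.ofReal (gagKer u p) := by
    apply setLIntegral_mono' ((JJ_meas N i).prod (JJ_meas N i))
    rintro ⟨a, b⟩ ⟨ha, hb⟩
    rw [← ENNReal.ofReal_mul (by positivity)]
    apply ENNReal.ofReal_le_ofReal
    simp only [gagKer]
    by_cases hab : a = b
    · subst hab; simp
    · have hpos : 0 < |a - b| := abs_pos.2 (sub_ne_zero.2 hab)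
      have hle : |a - b| ≤ 1 / N := by
        have e : ((i : ℝ) + 1) / N = i / N + 1 / N := by ring
        rw [abs_le]
        obtain ⟨a1, a2⟩ := ha
        obtain ⟨b1, b2⟩ := hb
        simp only at a1 a2 b1 b2
        rw [e] at a2 b2
        constructor <;> linarith
      rw [← mul_div_assoc, le_div_iff₀ (by positivity)]
      have : |a - b| ^ 2 ≤ (1 / (N:ℝ)) ^ 2 := pow_le_pow_left₀ hpos.le hle 2
      nlinarith [mul_le_mul_of_nonneg_left this (sq_nonneg (u b - u a))]
  rw [h1, JJ_vol]
  apply ENNReal.div_le_of_le_mul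
  refine h2.trans ?_
  rw [lintegral_const_mul' _ _ ENNReal.ofReal_ne_top, sq, ENNReal.ofReal_mul hh.le]
  rw [mul_assoc, mul_assoc, mul_comm (∫⁻ _ in _, _)]

lemma approx_all {u : ℝ → ℝ} (hu : memX u) {N : ℕ} (hN : 0 < N) :
    ∃ c : ℕ → ℝ, ∑ i ∈ Finset.range N, ∫⁻ x in JJ N i, ENNReal.ofReal ((u x - c i) ^ 2) ≤
      ENNReal.ofReal (gagSq u / N) := by
  choose c hc using fun i => approx_one hu.meas hN i
  refine ⟨c, (Finset.sum_le_sum fun i _ => hc i).trans ?_⟩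
  rw [← Finset.mul_sum, ← lintegral_biUnion_finset]
  · have : ENNReal.ofReal (gagSq u) = ∫⁻ p, ENNReal.ofReal (gagKer u p) := by
      unfold gagSq
      rw [ofReal_integral_eq_lintegral_ofReal hu.1.2.2]
      refine Eventually.of_forall fun p => ?_
      rw [gagKer_eq]; exact sq_nonneg _
    rw [show gagSq u / N = 1 / N * gagSq u by ring, ENNReal.ofReal_mul (by positivity), this]
    gcongr
    exact Measure.restrict_le_self
  · intro i _ j _ hij
    exact Set.disjoint_prod.2 (Or.inl (JJ_disj hN hij))
  · intro i _; exact (JJ_meas N i).prod (JJ_meas N i)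

lemma eLp2 {Ω : Type*} [MeasurableSpace Ω] (μ : Measure Ω) (v : Ω → ℝ) :
    eLpNorm v 2 μ = (∫⁻ x, ENNReal.ofReal (v x ^ 2) ∂μ) ^ (1 / 2 : ℝ) := by
  rw [eLpNorm_eq_lintegral_rpow_enorm_toReal (by norm_num) (by norm_num)]
  simp only [ENNReal.toReal_ofNat]
  congr 2; funext x
  rw [← sq_abs, ENNReal.ofReal_pow (abs_nonneg _), Real.enorm_eq_ofReal_abs]
  exact ENNReal.rpow_natCast _ 2

lemma c_bound {u : ℝ → ℝ} (hu : Measurable u) {N i : ℕ} {c A B : ℝ} (hN : 0 < N)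
    (h1 : ∫⁻ x in JJ N i, ENNReal.ofReal ((u x - c) ^ 2) ≤ ENNReal.ofReal B)
    (h2 : ∫⁻ x in JJ N i, ENNReal.ofReal ((u x) ^ 2) ≤ ENNReal.ofReal A) (hA : 0 ≤ A) (hB : 0 ≤ B) :
    c ^ 2 ≤ N * (2 * (B + A)) := by
  have hN' : (0 : ℝ) < N := by exact_mod_cast hN
  have h3 : ∫⁻ x in JJ N i, ENNReal.ofReal (c ^ 2) ≤
      ∫⁻ x in JJ N i, 2 * (ENNReal.ofReal ((u x - c) ^ 2) + ENNReal.ofReal ((u x) ^ 2)) := by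
    apply lintegral_mono
    intro x
    simp only
    rw [← ENNReal.ofReal_add (sq_nonneg _) (sq_nonneg _), ← ENNReal.ofReal_ofNat 2,
      ← ENNReal.ofReal_mul (by norm_num)]
    apply ENNReal.ofReal_le_ofReal
    nlinarith [sq_nonneg (u x - c + u x)]
  rw [lintegral_const_mul' _ _ (by norm_num), lintegral_add_left (by fun_prop), setLIntegral_const, JJ_vol,
    ← ENNReal.ofReal_mul (sq_nonneg _)] at h3
  have h4 := h3.trans (mul_le_mul_right (add_le_add h1 h2) 2)
  rw [← ENNReal.ofReal_add hB hA, ← ENNReal.ofReal_ofNat 2,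
      ← ENNReal.ofReal_mul (by norm_num), ENNReal.ofReal_le_ofReal_iff (by positivity)] at h4
  rw [mul_one_div, div_le_iff₀ hN'] at h4
  linarith


lemma dist_bound {c d : ℕ → ℝ} {a b : ℝ → ℝ} (ha : Measurable a) (hb : Measurable b)
    {N : ℕ} (hN : 0 < N) {B δ : ℝ} (hB : 0 ≤ B)
    (h1 : ∑ i ∈ Finset.range N, ∫⁻ x in JJ N i, ENNReal.ofReal ((a x - c i) ^ 2) ≤ ENNReal.ofReal B)
    (h2 : ∑ i ∈ Finset.range N, ∫⁻ x in JJ N i, ENNReal.ofReal ((b x - d i) ^ 2) ≤ ENNReal.ofReal B)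
    (hcd : ∀ i < N, |c i - d i| ≤ δ) :
    ∫⁻ x, ENNReal.ofReal ((a x - b x) ^ 2) ∂mu0 ≤ ENNReal.ofReal (3 * (2 * B + δ ^ 2)) := by
  have hN' : (0 : ℝ) < N := by exact_mod_cast hN
  have hi : ∀ i ∈ Finset.range N, ∫⁻ x in JJ N i, ENNReal.ofReal ((a x - b x) ^ 2) ≤
      3 * ((∫⁻ x in JJ N i, ENNReal.ofReal ((a x - c i) ^ 2)) +
        (∫⁻ x in JJ N i, ENNReal.ofReal ((b x - d i) ^ 2)) + ENNReal.ofReal (δ ^ 2 * (1 / N))) := by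
    intro i hi
    have hcd' := hcd i (Finset.mem_range.1 hi)
    have h3 : ∫⁻ x in JJ N i, ENNReal.ofReal ((a x - b x) ^ 2) ≤
      ∫⁻ x in JJ N i, 3 * (ENNReal.ofReal ((a x - c i) ^ 2) + ENNReal.ofReal ((b x - d i) ^ 2)
        + ENNReal.ofReal (δ ^ 2)) := by
      apply lintegral_mono
      intro x
      simp only
      rw [← ENNReal.ofReal_add (sq_nonneg _) (sq_nonneg _),
        ← ENNReal.ofReal_add (by positivity) (sq_nonneg _), ← ENNReal.ofReal_ofNat 3,
        ← ENNReal.ofReal_mul (by norm_num)]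
      apply ENNReal.ofReal_le_ofReal
      have h5 : (c i - d i) ^ 2 ≤ δ ^ 2 := by
        rw [← sq_abs]; exact pow_le_pow_left₀ (abs_nonneg _) hcd' 2
      nlinarith [sq_nonneg ((a x - c i) - (c i - d i)), sq_nonneg ((a x - c i) + (b x - d i)),
        sq_nonneg ((c i - d i) + (b x - d i))]
    rw [lintegral_const_mul' _ _ (by norm_num), lintegral_add_left (by fun_prop),
      lintegral_add_left (by fun_prop), setLIntegral_const, JJ_vol,
      ← ENNReal.ofReal_mul (sq_nonneg _)] at h3
    exact h3
  rw [lint_mu0 hN]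
  refine (Finset.sum_le_sum hi).trans ?_
  rw [← Finset.mul_sum, Finset.sum_add_distrib, Finset.sum_add_distrib, Finset.sum_const,
    Finset.card_range, nsmul_eq_mul, ← ENNReal.ofReal_natCast, ← ENNReal.ofReal_mul hN'.le]
  have e : (N:ℝ) * (δ ^ 2 * (1 / N)) = δ ^ 2 := by field_simp
  rw [e]
  refine (mul_le_mul_right (add_le_add (add_le_add h1 h2) le_rfl) 3).trans (le_of_eq ?_)
  rw [← ENNReal.ofReal_add hB hB, ← ENNReal.ofReal_add (by positivity) (sq_nonneg _),
    ← ENNReal.ofReal_ofNat 3, ← ENNReal.ofReal_mul (by norm_num)]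
  congr 1; ring

open Classical in
lemma compact_ae {u : ℕ → ℝ → ℝ} (hu : ∀ n, memX (u n)) {A B : ℝ} (hA : 0 ≤ A) (hB : 0 ≤ B)
    (hL : ∀ n, ∫⁻ x, ENNReal.ofReal (u n x ^ 2) ∂mu0 ≤ ENNReal.ofReal A)
    (hG : ∀ n, gagSq (u n) ≤ B) :
    ∃ w, memX w ∧ ∃ g : ℕ → ℕ, StrictMono g ∧
      ∀ᵐ x : ℝ, Tendsto (fun k => u (g k) x) atTop (𝓝 (w x)) := by
  have hmem : ∀ n, MemLp (u n) 2 mu0 := fun n => ((memX_iff _).1 (hu n)).2.1.restrict _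
  let U : ℕ → Lp ℝ 2 mu0 := fun n => (hmem n).toLp
  have htb : TotallyBounded (range U) := by
    rw [Metric.totallyBounded_iff]
    intro ε hε
    obtain ⟨N, hN⟩ := exists_nat_gt (12 * (B + 1) / ε ^ 2)
    have hN' : (0 : ℝ) < N := lt_trans (by positivity) hN
    have hN0 : 0 < N := by exact_mod_cast hN'
    have hBN : 0 ≤ B / N := by positivity
    set δ : ℝ := ε / 4 with hδ
    have hδ0 : 0 < δ := by positivity
    choose c hc using fun n => approx_all (hu n) hN0
    have hc' : ∀ n, ∑ i ∈ Finset.range N, ∫⁻ x in JJ N i, ENNReal.ofReal ((u n x - c n i) ^ 2) ≤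
      ENNReal.ofReal (B / N) := fun n => (hc n).trans (ENNReal.ofReal_le_ofReal (by
        gcongr; exact hG n))
    have hcb : ∀ n, ∀ i < N, |c n i| ≤ √(N * (2 * (B / N + A))) := by
      intro n i hi
      apply Real.abs_le_sqrt
      have hmi : i ∈ Finset.range N := Finset.mem_range.2 hi
      refine c_bound (i := i) (hu n).meas hN0 (le_trans ?_ (hc' n)) (le_trans ?_ (hL n)) hA hBN
      · exact Finset.single_le_sum (f := fun i => ∫⁻ x in JJ N i, ENNReal.ofReal ((u n x - c n i) ^ 2))
          (fun _ _ => zero_le) hmi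
      · rw [lint_mu0 hN0]
        exact Finset.single_le_sum (f := fun i => ∫⁻ x in JJ N i, ENNReal.ofReal ((u n x) ^ 2))
          (fun _ _ => zero_le) hmi
    set R := √(N * (2 * (B / N + A))) with hR
    let F : ℕ → (Fin N → ℤ) := fun n i => ⌊c n i / δ⌋
    have hfin : (range F).Finite := by
      refine (Set.Finite.pi' (t := fun _ : Fin N => Set.Icc (⌊-R / δ⌋) (⌊R / δ⌋))
        (fun _ => Set.finite_Icc _ _)).subset ?_
      rintro _ ⟨n, rfl⟩ i
      have := abs_le.1 (hcb n i i.2)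
      constructor <;> apply Int.floor_le_floor <;> gcongr <;> linarith
    let r : (Fin N → ℤ) → ℕ := fun b => if h : ∃ n, F n = b then h.choose else 0
    have hr : ∀ n, F (r (F n)) = F n := by
      intro n
      have h : ∃ m, F m = F n := ⟨n, rfl⟩
      simp only [r, dif_pos h]; exact h.choose_spec
    refine ⟨(fun b => U (r b)) '' range F, hfin.image _, ?_⟩
    rintro _ ⟨n, rfl⟩
    simp only [mem_iUnion]
    refine ⟨U (r (F n)), ⟨F n, ⟨n, rfl⟩, rfl⟩, ?_⟩
    rw [Metric.mem_ball, ← edist_lt_ofReal, Lp.edist_toLp_toLp, eLp2]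
    have hd := dist_bound (hu n).meas (hu (r (F n))).meas
      hN0 (δ := δ) hBN (hc' n) (hc' (r (F n))) (by
        intro i hi
        have := congrFun (hr n) ⟨i, hi⟩
        have h2 := Int.abs_sub_lt_one_of_floor_eq_floor this.symm
        rw [← sub_div, abs_div, abs_of_pos hδ0, div_lt_one hδ0] at h2
        exact h2.le)
    have e : ENNReal.ofReal ε = (ENNReal.ofReal (ε ^ 2)) ^ (1 / 2 : ℝ) := by
      rw [ENNReal.ofReal_rpow_of_pos (by positivity), ← Real.sqrt_eq_rpow, Real.sqrt_sq hε.le]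
    rw [e]
    apply ENNReal.rpow_lt_rpow _ (by norm_num)
    refine lt_of_le_of_lt hd ?_
    rw [ENNReal.ofReal_lt_ofReal_iff (by positivity)]
    rw [div_lt_iff₀ (by positivity)] at hN
    have : 12 * (B / N) < ε ^ 2 := by
      rw [← mul_div_assoc, div_lt_iff₀ hN']; linarith
    rw [hδ]; nlinarith
  have hcomp : IsCompact (closure (range U)) := htb.closure.isCompact_of_isClosed isClosed_closure
  obtain ⟨W, -, g0, hg0, hlim⟩ := hcomp.tendsto_subseq (x := U) (fun n => subset_closure ⟨n, rfl⟩)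
  obtain ⟨g1, hg1, hae⟩ := (tendstoInMeasure_of_tendsto_Lp hlim).exists_seq_tendsto_ae
  have hcoe : ∀ᵐ x ∂mu0, ∀ n, (U n : ℝ → ℝ) x = u n x := ae_all_iff.2 fun n => (hmem n).coeFn_toLp
  have hWm : Measurable (W : ℝ → ℝ) := (Lp.stronglyMeasurable W).measurable
  set w : ℝ → ℝ := (Ioo (0:ℝ) 1).indicator W with hw
  have hwm : Measurable w := hWm.indicator measurableSet_Ioo
  have hconv : ∀ᵐ x : ℝ, Tendsto (fun k => u (g0 (g1 k)) x) atTop (𝓝 (w x)) := by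
    have h0 : ∀ᵐ x : ℝ, ∀ n, x ∉ Ioo (0 : ℝ) 1 → u n x = 0 := ae_all_iff.2 fun n => (hu n).2
    have h1 : ∀ᵐ x : ℝ, x ∈ Ioo (0:ℝ) 1 → Tendsto (fun k => u (g0 (g1 k)) x) atTop (𝓝 (W x)) := by
      rw [← ae_restrict_iff' measurableSet_Ioo]
      filter_upwards [hae, hcoe] with x hx hy
      simpa only [Function.comp, hy] using hx
    filter_upwards [h0, h1] with x hx hy
    by_cases hxI : x ∈ Ioo (0:ℝ) 1
    · rw [hw, indicator_of_mem hxI]; exact hy hxI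
    · rw [hw, indicator_of_notMem hxI]
      simp only [hx _ hxI]; exact tendsto_const_nhds
  refine ⟨w, (memX_iff w).2 ⟨hwm, (memLp_indicator_iff_restrict measurableSet_Ioo).2 (Lp.memLp W), ?_, ?_⟩,
    g0 ∘ g1, hg0.comp hg1, hconv⟩
  · refine ⟨(dq_measurable hwm).aestronglyMeasurable, ?_⟩
    have hc2 : ∀ᵐ p : ℝ × ℝ, Tendsto (fun k => dq (u (g0 (g1 k))) p) atTop (𝓝 (dq w p)) := by
      have h1 := Measure.quasiMeasurePreserving_fst (μ := (volume : Measure ℝ)) (ν := (volume : Measure ℝ)) |>.ae hconv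
      have h2 := Measure.quasiMeasurePreserving_snd (μ := (volume : Measure ℝ)) (ν := (volume : Measure ℝ)) |>.ae hconv
      rw [Measure.volume_eq_prod]
      filter_upwards [h1, h2] with p a b
      exact (a.sub b).div_const _
    refine lt_of_le_of_lt (Lp.eLpNorm_lim_le_liminf_eLpNorm
      (fun k => (dq_measurable (hu (g0 (g1 k))).meas).aestronglyMeasurable) _ hc2) ?_
    refine lt_of_le_of_lt (Filter.liminf_le_of_frequently_le' (x := ENNReal.ofReal B ^ (1 / 2 : ℝ))
      (Eventually.of_forall fun k => ?_).frequently) (ENNReal.rpow_lt_top_of_nonneg (by norm_num) ENNReal.ofReal_ne_top)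
    rw [eLp2]
    gcongr
    rw [← ofReal_integral_eq_lintegral_ofReal (hu _).dq2.integrable_sq (Eventually.of_forall fun p => sq_nonneg _),
      ← gagSq_eq]
    exact ENNReal.ofReal_le_ofReal (hG _)
  · exact Eventually.of_forall fun x hx => by rw [hw, indicator_of_notMem hx]


lemma primF_cont {f : ℝ → ℝ} (hcont : Continuous f) : Continuous (primF f) :=
  intervalIntegral.continuous_primitive (fun a b => hcont.intervalIntegrable a b) 0

lemma primF_zero (f : ℝ → ℝ) : primF f 0 = 0 := by simp [primF]

lemma F_facts {f : ℝ → ℝ} 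
    (hii : ∀ t : ℝ, t ≠ 0 → 0 < 2 * primF f t ∧ 2 * primF f t ≤ f t * t) (t : ℝ) :
    0 ≤ primF f t ∧ 2 * primF f t ≤ f t * t ∧ f t * t = |f t| * |t| := by
  have h : 0 ≤ primF f t ∧ 2 * primF f t ≤ f t * t := by
    by_cases ht : t = 0
    · subst ht; simp [primF_zero]
    · obtain ⟨a, b⟩ := hii t ht
      exact ⟨by linarith, b⟩
  refine ⟨h.1, h.2, ?_⟩
  rw [← abs_mul, abs_of_nonneg (by linarith)]

lemma bdd_on {h : ℝ → ℝ} (hc : Continuous h) (T : ℝ) : ∃ S : ℝ, 0 ≤ S ∧ ∀ t, |t| ≤ T → |h t| ≤ S := by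
  obtain ⟨S, hS⟩ := (isCompact_Icc (a := -T) (b := T)).exists_bound_of_continuousOn hc.continuousOn
  refine ⟨max S 0, le_max_right _ _, fun t ht => ?_⟩
  exact (hS t (abs_le.1 ht)).trans (le_max_left _ _)

lemma AR {f : ℝ → ℝ} (hcont : Continuous f)
    (hi : ∃ t₀ > (0 : ℝ), ∃ M > (0 : ℝ),
      ∀ t : ℝ, t₀ ≤ |t| → 0 < primF f t ∧ primF f t ≤ M * |f t|)
    (hii : ∀ t : ℝ, t ≠ 0 → 0 < 2 * primF f t ∧ 2 * primF f t ≤ f t * t) :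
    ∃ M : ℝ, 0 < M ∧ ∃ C : ℝ, 0 ≤ C ∧ ∀ t, 4 * primF f t ≤ f t * t + C ∧ |primF f t| ≤ M * |f t| + C := by
  obtain ⟨t₀, ht₀, M, hM, h⟩ := hi
  obtain ⟨S, hS0, hS⟩ := bdd_on (primF_cont hcont) (max t₀ (4 * M))
  refine ⟨M, hM, 4 * S, by positivity, fun t => ?_⟩
  obtain ⟨h1, h2, h3⟩ := F_facts hii t
  rw [abs_of_nonneg h1]
  rcases le_total |t| (max t₀ (4 * M)) with ht | ht
  · have := hS t ht
    rw [abs_of_nonneg h1] at this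
    have h5 : 0 ≤ M * |f t| := by positivity
    constructor <;> linarith
  · obtain ⟨h5, h6⟩ := h t ((le_max_left _ _).trans ht)
    have h7 : 4 * M ≤ |t| := (le_max_right _ _).trans ht
    refine ⟨?_, by linarith⟩
    rw [h3]
    nlinarith [mul_le_mul_of_nonneg_left h7 (abs_nonneg (f t))]

lemma weak_conv {u : ℕ → ℝ → ℝ} (hu : ∀ n, memX (u n)) {w v : ℝ → ℝ} (hw : memX w) (hv : memX v)
    {B : ℝ} (hB : ∀ n, gagSq (u n) ≤ B)
    (hae : ∀ᵐ x : ℝ, Tendsto (fun k => u k x) atTop (𝓝 (w x))) :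
    Tendsto (fun n => innerX v (fun x => u n x - w x)) atTop (𝓝 0) := by
  have hB0 : 0 ≤ B := (gagSq_nonneg _).trans (hB 0)
  have hw0 := gagSq_nonneg w
  set L := 2 * B + 2 * gagSq w + 1 with hL
  have hL0 : 0 < L := by positivity
  have hLb : ∀ n, gagSq (fun x => u n x - w x) ≤ L := by
    intro n
    have e : gagSq (fun x => u n x - w x) ≤ ∫ p, (2 * dq (u n) p ^ 2 + 2 * dq w p ^ 2) := by
      rw [gagSq_eq]
      refine integral_mono (((hu n).sub hw).dq2.integrable_sq)
        (((hu n).dq2.integrable_sq.const_mul 2).add (hw.dq2.integrable_sq.const_mul 2)) ?_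
      intro p
      simp only [dq_sub]
      nlinarith [sq_nonneg (dq (u n) p + dq w p)]
    rw [integral_add ((hu n).dq2.integrable_sq.const_mul 2) (hw.dq2.integrable_sq.const_mul 2),
      integral_const_mul, integral_const_mul, ← gagSq_eq, ← gagSq_eq] at e
    linarith [hB n]
  simp only [innerX_eq]
  apply gdc volume
  · intro n
    exact (dq_measurable hv.meas).mul (dq_measurable ((hu n).sub hw).meas)
  · have h1 := Measure.quasiMeasurePreserving_fst (μ := (volume : Measure ℝ)) (ν := (volume : Measure ℝ)) |>.ae hae
    have h2 := Measure.quasiMeasurePreserving_snd (μ := (volume : Measure ℝ)) (ν := (volume : Measure ℝ)) |>.ae hae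
    rw [Measure.volume_eq_prod]
    filter_upwards [h1, h2] with p a b
    have c1 : Tendsto (fun k => dq (u k) p) atTop (𝓝 (dq w p)) := (a.sub b).div_const _
    have := (c1.sub_const (dq w p)).const_mul (dq v p)
    simp only [dq_sub]
    simpa using this
  · intro ε hε
    refine ⟨fun p => (L / ε) * dq v p ^ 2, hv.dq2.integrable_sq.const_mul _,
      fun n p => (ε / L) * dq (fun x => u n x - w x) p ^ 2, Eventually.of_forall fun n => ⟨?_, ?_, ?_⟩⟩
    · intro p
      change |dq v p * dq (fun x => u n x - w x) p| ≤ L / ε * dq v p ^ 2 + ε / L * dq (fun x => u n x - w x) p ^ 2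
      set a := dq v p
      set b := dq (fun x => u n x - w x) p
      set s := √(ε / L) with hs
      have hs2 : s ^ 2 = ε / L := Real.sq_sqrt (by positivity)
      have hs0 : 0 < s := Real.sqrt_pos.2 (by positivity)
      have e1 : L / ε = (s⁻¹) ^ 2 := by rw [inv_pow, hs2, inv_div]
      rw [e1, ← hs2, abs_mul, ← sq_abs a, ← sq_abs b, ← mul_pow, ← mul_pow]
      have e2 : |a| * |b| = (s⁻¹ * |a|) * (s * |b|) := by field_simp
      rw [e2]
      nlinarith [sq_nonneg (s⁻¹ * |a| - s * |b|), mul_nonneg (mul_nonneg (inv_nonneg.2 hs0.le) (abs_nonneg a)) (mul_nonneg hs0.le (abs_nonneg b))]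
    · intro p; positivity
    · rw [← ofReal_integral_eq_lintegral_ofReal
        (((hu n).sub hw).dq2.integrable_sq.const_mul _) (Eventually.of_forall fun p => by positivity),
        integral_const_mul, ← gagSq_eq]
      apply ENNReal.ofReal_le_ofReal
      rw [div_mul_eq_mul_div, div_le_iff₀ hL0]
      exact mul_le_mul_of_nonneg_left (hLb n) hε.le

lemma vitali {f h : ℝ → ℝ} (hcont : Continuous f) (hh : Continuous h)
    (hii : ∀ t : ℝ, t ≠ 0 → 0 < 2 * primF f t ∧ 2 * primF f t ≤ f t * t)
    {M C V Q : ℝ} (hM : 0 < M) (hV : 0 < V) (hQ : 0 < Q)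
    (hb : ∀ t, |h t| ≤ M * |f t| + C) {u : ℕ → ℝ → ℝ} {w v : ℝ → ℝ} (hu : ∀ n, Measurable (u n))
    (hw : Measurable w) (hv : Measurable v) (hvb : ∀ x, |v x| ≤ V)
    (hae : ∀ᵐ x ∂mu0, Tendsto (fun k => u k x) atTop (𝓝 (w x)))
    (hint : ∀ n, Integrable (fun x => f (u n x) * u n x) mu0)
    (hQb : ∀ n, ∫ x, f (u n x) * u n x ∂mu0 ≤ Q) (hwi : Integrable (fun x => h (w x)) mu0) :
    Tendsto (fun n => ∫ x, (h (u n x) - h (w x)) * v x ∂mu0) atTop (𝓝 0) := by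
  apply gdc mu0
  · intro n
    exact ((hh.measurable.comp (hu n)).sub (hh.measurable.comp hw)).mul hv
  · filter_upwards [hae] with x hx
    have := (((hh.tendsto (w x)).comp hx).sub_const (h (w x))).mul_const (v x)
    simpa using this
  · intro ε hε
    set K := V * M * Q / ε with hK
    have hK0 : 0 < K := by positivity
    obtain ⟨S, hS0, hS⟩ := bdd_on hcont K
    have hfb : ∀ t, |f t| ≤ S + f t * t / K := by
      intro t
      obtain ⟨h1, h2, h3⟩ := F_facts hii t
      rcases le_total |t| K with ht | ht
      · have : 0 ≤ f t * t / K := div_nonneg (by linarith) hK0.le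
        linarith [hS t ht]
      · have : |f t| ≤ f t * t / K := by
          rw [le_div_iff₀ hK0, h3]
          exact mul_le_mul_of_nonneg_left ht (abs_nonneg _)
        linarith
    refine ⟨fun x => V * (M * S + C + |h (w x)|), ((integrable_const _).add hwi.abs).const_mul V,
      fun n x => V * M / K * (f (u n x) * u n x), Eventually.of_forall fun n => ⟨?_, ?_, ?_⟩⟩
    · intro x
      have h1 := hb (u n x)
      have h2 := hfb (u n x)
      have h3 := abs_sub (h (u n x)) (h (w x))
      have h4 := mul_le_mul_of_nonneg_left h2 hM.le
      rw [abs_mul]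
      calc |h (u n x) - h (w x)| * |v x| ≤ (M * (S + f (u n x) * u n x / K) + C + |h (w x)|) * V := by
            apply mul_le_mul (by linarith) (hvb x) (abs_nonneg _)
            linarith [abs_nonneg (h (u n x) - h (w x))]
        _ = _ := by ring
    · intro x
      obtain ⟨h1, h2, h3⟩ := F_facts hii (u n x)
      have : 0 ≤ f (u n x) * u n x := by linarith
      positivity
    · rw [← ofReal_integral_eq_lintegral_ofReal ((hint n).const_mul _) (Eventually.of_forall fun x => by
        obtain ⟨h1, h2, h3⟩ := F_facts hii (u n x)
        have : 0 ≤ f (u n x) * u n x := by linarith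
        change 0 ≤ _
        positivity), integral_const_mul]
      apply ENNReal.ofReal_le_ofReal
      calc V * M / K * ∫ x, f (u n x) * u n x ∂mu0 ≤ V * M / K * Q :=
            mul_le_mul_of_nonneg_left (hQb n) (by positivity)
        _ = ε := by rw [hK]; field_simp

lemma strong_int {ω : ℝ} (hω0 : 0 < ω) (hTM : TMprop ω)
    {f : ℝ → ℝ} (hcont : Continuous f) {α₀ : ℝ} (hα₀0 : 0 < α₀)
    (hiv2 : ∀ α : ℝ, α₀ < α →
      Filter.Tendsto (fun t => |f t| * exp (-α * t ^ 2)) (Filter.cocompact ℝ) (𝓝 0))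
    {u : ℕ → ℝ → ℝ} (hu : ∀ n, memX (u n)) {w : ℝ → ℝ} (hw : memX w)
    (hae : ∀ᵐ x ∂mu0, Tendsto (fun k => u k x) atTop (𝓝 (w x))) {ρ : ℝ} (hρ : 0 < ρ)
    (hρ2 : α₀ * ρ < 2 * π * ω)
    (hev : ∀ᶠ n in atTop, gagSq (fun x => u n x - w x) ≤ ρ) :
    Tendsto (fun n => ∫ x, f (u n x) * (u n x - w x) ∂mu0) atTop (𝓝 0) := by
  obtain ⟨t, ht1, ht⟩ : ∃ t : ℝ, 1 < t ∧ t ^ 4 * α₀ * ρ < 2 * π * ω := by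
    have hc : Continuous (fun t : ℝ => t ^ 4 * α₀ * ρ) := by fun_prop
    have h1 : Tendsto (fun t : ℝ => t ^ 4 * α₀ * ρ) (𝓝[>] 1) (𝓝 (1 ^ 4 * α₀ * ρ)) :=
      (hc.tendsto 1).mono_left nhdsWithin_le_nhds
    have h2 := h1.eventually_lt_const (by simpa using hρ2)
    obtain ⟨t, a, b⟩ := (h2.and self_mem_nhdsWithin).exists
    exact ⟨t, b, a⟩
  have ht0 : 0 < t := by linarith
  have ht2 : 0 < t - 1 := by linarith
  obtain ⟨C, hC, hCb⟩ := f_bound hcont (α := t * α₀) (by positivity) (hiv2 _ (by nlinarith))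
  obtain ⟨K, hK, hKb⟩ := TM_scaled hTM (α := t ^ 4 * α₀) (by positivity) hρ ht
  set κ : ℝ := (t - 1) * (t ^ 2 * α₀) with hκ
  have hκ0 : 0 < κ := by positivity
  set C' : ℝ := C * (1 + 1 / κ) with hC'
  have hC'0 : 0 < C' := by positivity
  set b : ℝ := t * α₀ * (t / (t - 1)) with hb
  have key : ∀ z s l : ℝ, |f (z + s) * z| ≤ C' * exp (b * s ^ 2 + (b * s ^ 2 + l) / (t - 1)) +
      C' * exp (-l) * exp (t ^ 4 * α₀ * z ^ 2) := by
    intro z s l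
    have h1 : (z + s) ^ 2 ≤ t * z ^ 2 + t / (t - 1) * s ^ 2 := by
      have : t * z ^ 2 + t / (t - 1) * s ^ 2 - (z + s) ^ 2 = ((t - 1) * z - s) ^ 2 / (t - 1) := by
        field_simp; ring
      have h2 : 0 ≤ ((t - 1) * z - s) ^ 2 / (t - 1) := by positivity
      linarith
    have h2 : |f (z + s)| ≤ C * exp (t ^ 2 * α₀ * z ^ 2 + b * s ^ 2) := by
      refine (hCb _).trans ?_
      gcongr
      calc t * α₀ * (z + s) ^ 2 ≤ t * α₀ * (t * z ^ 2 + t / (t - 1) * s ^ 2) := by gcongr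
        _ = _ := by rw [hb]; ring
    have h3 : |z| ≤ (1 + 1 / κ) * exp (κ * z ^ 2) := by
      have e1 := add_one_le_exp (κ * z ^ 2)
      have e2 : (1 + 1 / κ) * (κ * z ^ 2 + 1) = 1 + 1 / κ + κ * z ^ 2 + z ^ 2 := by
        field_simp; ring
      have e3 : (1 + 1 / κ) * (κ * z ^ 2 + 1) ≤ (1 + 1 / κ) * exp (κ * z ^ 2) := by gcongr
      have e4 : 0 < 1 / κ := by positivity
      have e5 : 0 ≤ κ * z ^ 2 := by positivity
      have e6 : |z| ≤ 1 + z ^ 2 := by rw [← sq_abs]; nlinarith [sq_nonneg (|z| - 1)]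
      linarith
    have h4 : |f (z + s) * z| ≤ C' * exp (b * s ^ 2 + t ^ 3 * α₀ * z ^ 2) := by
      rw [abs_mul]
      calc |f (z + s)| * |z| ≤ (C * exp (t ^ 2 * α₀ * z ^ 2 + b * s ^ 2)) * ((1 + 1 / κ) * exp (κ * z ^ 2)) := by
            gcongr
        _ = C' * (exp (t ^ 2 * α₀ * z ^ 2 + b * s ^ 2) * exp (κ * z ^ 2)) := by rw [hC']; ring
        _ = _ := by rw [← exp_add, hκ]; ring_nf
    refine h4.trans ?_
    rw [mul_assoc C' (exp (-l)), ← mul_add, ← exp_add]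
    apply mul_le_mul_of_nonneg_left _ hC'0.le
    set y := t ^ 3 * α₀ * z ^ 2 with hy
    have ey : t ^ 4 * α₀ * z ^ 2 = t * y := by rw [hy]; ring
    rw [ey]
    rcases le_total (b * s ^ 2 + y) (-l + t * y) with h | h
    · exact (exp_le_exp.2 h).trans (le_add_of_nonneg_left (exp_pos _).le)
    · refine le_trans (exp_le_exp.2 ?_) (le_add_of_nonneg_right (exp_pos _).le)
      have : y ≤ (b * s ^ 2 + l) / (t - 1) := by
        rw [le_div_iff₀ ht2]; linarith
      linarith
  apply gdc mu0
  · intro n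
    exact (hcont.measurable.comp (hu n).meas).mul ((hu n).meas.sub hw.meas)
  · filter_upwards [hae] with x hx
    have := ((hcont.tendsto (w x)).comp hx).mul (hx.sub_const (w x))
    simpa using this
  · intro ε hε
    set l := Real.log (C' * K / ε) with hl
    have hel : exp (-l) = ε / (C' * K) := by
      rw [exp_neg, hl, exp_log (by positivity), inv_div]
    refine ⟨fun x => C' * exp (b * w x ^ 2 + (b * w x ^ 2 + l) / (t - 1)), ?_,
      fun n x => C' * exp (-l) * exp (t ^ 4 * α₀ * (u n x - w x) ^ 2), ?_⟩
    · have := (exp_int hω0 hTM hw (b + b / (t - 1))).const_mul (C' * exp (l / (t - 1)))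
      refine this.congr (Eventually.of_forall fun x => ?_)
      simp only
      rw [mul_assoc, ← exp_add]
      congr 2; ring
    · filter_upwards [hev] with n hn
      refine ⟨fun x => ?_, fun x => by positivity, ?_⟩
      · have := key (u n x - w x) (w x) l
        rwa [sub_add_cancel] at this
      · have h1 := hKb _ ((hu n).sub hw) hn
        have h2 : ∀ x, ENNReal.ofReal (C' * exp (-l) * exp (t ^ 4 * α₀ * (u n x - w x) ^ 2)) =
          ENNReal.ofReal (C' * exp (-l)) * ENNReal.ofReal (exp (t ^ 4 * α₀ * (u n x - w x) ^ 2)) :=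
          fun x => ENNReal.ofReal_mul (by positivity)
        simp only [h2]
        rw [lintegral_const_mul' _ _ ENNReal.ofReal_ne_top]
        refine (mul_le_mul_right h1 _).trans ?_
        rw [← ENNReal.ofReal_mul (by positivity), hel]
        apply ENNReal.ofReal_le_ofReal
        apply le_of_eq; field_simp


lemma gagSq_trc_le {u : ℝ → ℝ} (hu : memX u) (k : ℕ) : gagSq (fun x => trc k (u x)) ≤ gagSq u := by
  rw [gagSq_eq, gagSq_eq]
  refine integral_mono (hu.trc k).dq2.integrable_sq hu.dq2.integrable_sq fun p => ?_
  simp only [dq]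
  rw [sq_le_sq, abs_div, abs_div]
  exact div_le_div_of_nonneg_right (trc_lip _ _ _) (abs_nonneg _)

lemma mu0_const (C : ℝ) : ∫ _x, C ∂mu0 = C := by simp [mu0]

lemma Fu_int {f : ℝ → ℝ} (hcont : Continuous f)
    (hii : ∀ t : ℝ, t ≠ 0 → 0 < 2 * primF f t ∧ 2 * primF f t ≤ f t * t) {u : ℝ → ℝ}
    (hu : memX u) (h : Integrable (fun x => f (u x) * u x) mu0) :
    Integrable (fun x => primF f (u x)) mu0 := by
  refine h.mono ((primF_cont hcont).measurable.comp hu.meas).aestronglyMeasurable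
    (Eventually.of_forall fun x => ?_)
  obtain ⟨h1, h2, h3⟩ := F_facts hii (u x)
  rw [Real.norm_eq_abs, Real.norm_eq_abs, abs_of_nonneg h1, abs_of_nonneg (by linarith)]
  linarith

lemma ps_bdd {f : ℝ → ℝ} (hcont : Continuous f)
    (hii : ∀ t : ℝ, t ≠ 0 → 0 < 2 * primF f t ∧ 2 * primF f t ≤ f t * t)
    {C P E : ℝ} (hE : 0 ≤ E) (hC : ∀ t, 4 * primF f t ≤ f t * t + C) {u : ℝ → ℝ}
    (hu : memX u) (h : Integrable (fun x => f (u x) * u x) mu0) (hP : phi f u ≤ P)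
    (hd : |phiDeriv f u u| ≤ E * (1 + gagNorm u)) :
    gagSq u ≤ 2 * (8 * π * (P + C / 4 + E / 4)) + (2 * π * E) ^ 2 := by
  have hpi := Real.pi_pos
  have h1 : 4 * ∫ x, primF f (u x) ∂mu0 ≤ (∫ x, f (u x) * u x ∂mu0) + C := by
    rw [← integral_const_mul]
    have e := mu0_const C
    rw [← e, ← integral_add h (integrable_const _)]
    exact integral_mono ((Fu_int hcont hii hu h).const_mul 4) (h.add (integrable_const _))
      fun x => hC (u x)
  unfold phi at hP
  have h2 := (abs_le.1 hd).1
  unfold phiDeriv at h2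
  rw [innerX_self] at h2
  have h3 := gagNorm_sq u
  have h4 : gagSq u / (8 * π) ≤ P + C / 4 + E * (1 + gagNorm u) / 4 := by
    have e : gagSq u / (8 * π) = gagSq u / (4 * π) - gagSq u / (2 * π) / 4 := by
      field_simp; ring
    rw [e]; linarith
  rw [div_le_iff₀ (by positivity), ← h3] at h4
  rw [← h3]
  nlinarith [sq_nonneg (gagNorm u - 2 * π * E)]

lemma l2_bdd {ω : ℝ} (hω0 : 0 < ω) (hTM : TMprop ω) {B : ℝ} (hB : 0 ≤ B) :
    ∃ A : ℝ, 0 ≤ A ∧ ∀ u, memX u → gagSq u ≤ B →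
      ∫⁻ x, ENNReal.ofReal (u x ^ 2) ∂mu0 ≤ ENNReal.ofReal A := by
  have hpi := Real.pi_pos
  set α := π * ω / (B + 1) with hα
  have hα0 : 0 < α := by positivity
  obtain ⟨K, hK, h⟩ := TM_scaled hTM (α := α) (ρ := B + 1) hα0 (by positivity) (by
    rw [hα, div_mul_cancel₀ _ (by positivity)]; nlinarith [mul_pos hpi hω0])
  refine ⟨α⁻¹ * K, by positivity, fun u hu hb => ?_⟩
  calc ∫⁻ x, ENNReal.ofReal (u x ^ 2) ∂mu0
      ≤ ∫⁻ x, ENNReal.ofReal α⁻¹ * ENNReal.ofReal (exp (α * u x ^ 2)) ∂mu0 := by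
        apply lintegral_mono
        intro x
        change ENNReal.ofReal (u x ^ 2) ≤ ENNReal.ofReal α⁻¹ * ENNReal.ofReal (exp (α * u x ^ 2))
        rw [← ENNReal.ofReal_mul (by positivity)]
        apply ENNReal.ofReal_le_ofReal
        rw [← div_eq_inv_mul, le_div_iff₀ hα0]
        linarith [add_one_le_exp (α * u x ^ 2)]
    _ = ENNReal.ofReal α⁻¹ * ∫⁻ x, ENNReal.ofReal (exp (α * u x ^ 2)) ∂mu0 :=
        lintegral_const_mul' _ _ ENNReal.ofReal_ne_top
    _ ≤ _ := by
        rw [ENNReal.ofReal_mul (by positivity)]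
        gcongr
        exact h u hu (by linarith)

lemma weak_sol {ω : ℝ} (hω0 : 0 < ω) (hTM : TMprop ω) {f : ℝ → ℝ} (hcont : Continuous f)
    {α C : ℝ} (hC : ∀ t, |f t| ≤ C * exp (α * t ^ 2)) {w : ℝ → ℝ} (hw : memX w)
    (h : ∀ k : ℕ, innerX w (fun x => trc k (w x)) / (2 * π) = ∫ x, f (w x) * trc k (w x) ∂mu0) :
    gagSq w / (2 * π) = ∫ x, f (w x) * w x ∂mu0 := by
  have h1 : Tendsto (fun k : ℕ => innerX w (fun x => trc k (w x) - w x)) atTop (𝓝 0) := by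
    refine weak_conv (fun k => hw.trc k) hw hw (fun k => gagSq_trc_le hw k) (Eventually.of_forall fun x => ?_)
    exact tendsto_const_nhds.congr' ((trc_eventually (w x)).mono fun k hk => hk.symm)
  have h2 : Tendsto (fun k : ℕ => innerX w (fun x => trc k (w x))) atTop (𝓝 (gagSq w)) := by
    have := h1.add_const (gagSq w)
    rw [zero_add] at this
    refine this.congr fun k => ?_
    rw [innerX_sub_right hw (hw.trc k) hw, innerX_self]; ring
  have h3 : Tendsto (fun k : ℕ => ∫ x, f (w x) * trc k (w x) ∂mu0) atTop
      (𝓝 (∫ x, f (w x) * w x ∂mu0)) := by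
    refine tendsto_integral_of_dominated_convergence (fun x => ‖f (w x) * w x‖) (fun k => ?_)
      (fuv_int hω0 hTM hcont hC hw hw).norm (fun k => Eventually.of_forall fun x => ?_)
      (Eventually.of_forall fun x => ?_)
    · exact (fuv_int hω0 hTM hcont hC hw (hw.trc k)).aestronglyMeasurable
    · rw [norm_mul, norm_mul]
      exact mul_le_mul_of_nonneg_left (trc_abs_le' (Nat.cast_nonneg k) _) (norm_nonneg _)
    · exact tendsto_const_nhds.congr' ((trc_eventually (w x)).mono fun k hk => by simp only [hk])
  refine tendsto_nhds_unique ((h2.div_const (2 * π)).congr h) h3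

lemma fu_int1 {ω : ℝ} (hω0 : 0 < ω) (hTM : TMprop ω) {f : ℝ → ℝ} (hcont : Continuous f)
    {α C : ℝ} (hC : ∀ t, |f t| ≤ C * exp (α * t ^ 2)) {w : ℝ → ℝ} (hw : memX w) :
    Integrable (fun x => f (w x)) mu0 := by
  refine ((exp_int hω0 hTM hw α).const_mul C).mono (hcont.measurable.comp hw.meas).aestronglyMeasurable
    (Eventually.of_forall fun x => ?_)
  exact (hC (w x)).trans (le_abs_self _)

theorem main_aux (ω : ℝ) (hω0 : 0 < ω) (hTM : TMprop ω)
    (f : ℝ → ℝ) (hcont : Continuous f)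
    (hi : ∃ t₀ > (0 : ℝ), ∃ M > (0 : ℝ),
      ∀ t : ℝ, t₀ ≤ |t| → 0 < primF f t ∧ primF f t ≤ M * |f t|)
    (hii : ∀ t : ℝ, t ≠ 0 → 0 < 2 * primF f t ∧ 2 * primF f t ≤ f t * t)
    (α₀ : ℝ) (hα₀0 : 0 < α₀)
    (hiv2 : ∀ α : ℝ, α₀ < α →
      Filter.Tendsto (fun t => |f t| * exp (-α * t ^ 2)) (Filter.cocompact ℝ) (𝓝 0)) :
    ∀ c : ℝ, c < ω / (2 * α₀) → PalaisSmaleAt f c := by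
  have hpi := Real.pi_pos
  obtain ⟨M, hM, C1, hC1, hAR⟩ := AR hcont hi hii
  obtain ⟨C, hC, hfb⟩ := f_bound hcont (α := 2 * α₀) (by positivity) (hiv2 _ (by linarith))
  intro c hc u0 hu0 hφ0 hder0
  obtain ⟨ε0, hε0, hder0⟩ := hder0
  have hint : ∀ u v, memX u → memX v → Integrable (fun x => f (u x) * v x) mu0 :=
    fun u v hu hv => fuv_int hω0 hTM hcont hfb hu hv
  obtain ⟨P, hP⟩ := hφ0.bddAbove_range
  obtain ⟨E, hE⟩ := hε0.bddAbove_range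
  have hP' : ∀ n, phi f (u0 n) ≤ P := fun n => hP ⟨n, rfl⟩
  have hE' : ∀ n, ε0 n ≤ E := fun n => hE ⟨n, rfl⟩
  have hε00 : ∀ n, 0 ≤ ε0 n := fun n => by
    have hz : memX (fun x => 0 * u0 n x) := (hu0 n).smul 0
    refine (abs_nonneg _).trans (hder0 n _ hz ?_)
    have := gagSq_smul 0 (u0 n)
    unfold gagNorm
    rw [this]; simp
  have hE0 : 0 ≤ E := (hε00 0).trans (hE' 0)
  have hdu : ∀ n, |phiDeriv f (u0 n) (u0 n)| ≤ E * (1 + gagNorm (u0 n)) := fun n => by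
    refine (phiDeriv_bound (hder0 n) (hu0 n)).trans ?_
    have : 0 ≤ gagNorm (u0 n) := Real.sqrt_nonneg _
    exact mul_le_mul_of_nonneg_right (hE' n) (by linarith)
  obtain ⟨B, hB⟩ : ∃ B, ∀ n, gagSq (u0 n) ≤ B := ⟨_, fun n =>
    ps_bdd hcont hii hE0 (fun t => (hAR t).1) (hu0 n) (hint _ _ (hu0 n) (hu0 n)) (hP' n) (hdu n)⟩
  have hB0 : 0 ≤ B := (gagSq_nonneg _).trans (hB 0)
  have hN : ∀ n, gagNorm (u0 n) ≤ 1 + B := fun n => by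
    have h1 := gagNorm_sq (u0 n)
    nlinarith [hB n, sq_nonneg (gagNorm (u0 n) - 1)]
  obtain ⟨A, hA0, hA⟩ := l2_bdd hω0 hTM hB0
  obtain ⟨w, hw, g, hg, hae⟩ := compact_ae hu0 hA0 hB0 (fun n => hA _ (hu0 n) (hB n)) hB
  refine ⟨w, hw, g, hg, ?_⟩
  obtain ⟨u, hu_def⟩ : ∃ u : ℕ → ℝ → ℝ, u = fun k => u0 (g k) := ⟨_, rfl⟩
  have hu : ∀ n, memX (u n) := fun n => by rw [hu_def]; exact hu0 _
  have huB : ∀ n, gagSq (u n) ≤ B := fun n => by rw [hu_def]; exact hB _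
  have huN : ∀ n, gagNorm (u n) ≤ 1 + B := fun n => by rw [hu_def]; exact hN _
  have hφ : Tendsto (fun n => phi f (u n)) atTop (𝓝 c) := by
    rw [hu_def]; exact hφ0.comp hg.tendsto_atTop
  obtain ⟨ε, hε_def⟩ : ∃ ε : ℕ → ℝ, ε = fun k => ε0 (g k) := ⟨_, rfl⟩
  have hε : Tendsto ε atTop (𝓝 0) := by rw [hε_def]; exact hε0.comp hg.tendsto_atTop
  have hε1 : ∀ n, 0 ≤ ε n := fun n => by rw [hε_def]; exact hε00 _
  have hder : ∀ n, ∀ v : ℝ → ℝ, memX v → |phiDeriv f (u n) v| ≤ ε n * (1 + gagNorm v) := fun n v hv => by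
    rw [hu_def, hε_def]; exact phiDeriv_bound (hder0 _) hv
  have hdu' : ∀ n, |phiDeriv f (u n) (u n)| ≤ E * (1 + gagNorm (u n)) := fun n => by
    rw [hu_def]; exact hdu _
  have hae : ∀ᵐ x : ℝ, Tendsto (fun k => u k x) atTop (𝓝 (w x)) := by rw [hu_def]; exact hae
  suffices hs : Tendsto (fun k => gagNorm (fun x => u k x - w x)) atTop (𝓝 0) by
    rw [hu_def] at hs; exact hs
  clear hu_def hε_def
  have hae0 : ∀ᵐ x ∂mu0, Tendsto (fun k => u k x) atTop (𝓝 (w x)) := ae_restrict_of_ae hae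
  -- bound on the nonlinear term
  obtain ⟨Q, hQ0, hQ⟩ : ∃ Q : ℝ, 0 < Q ∧ ∀ n, ∫ x, f (u n x) * u n x ∂mu0 ≤ Q := by
    refine ⟨B / (2 * π) + E * (1 + (1 + B)) + 1, by positivity, fun n => ?_⟩
    have h1 := (abs_le.1 (hdu' n)).1
    unfold phiDeriv at h1
    rw [innerX_self] at h1
    have h2 : gagSq (u n) / (2 * π) ≤ B / (2 * π) := div_le_div_of_nonneg_right (huB n) (by positivity)
    have h3 : E * (1 + gagNorm (u n)) ≤ E * (1 + (1 + B)) :=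
      mul_le_mul_of_nonneg_left (by linarith [huN n]) hE0
    linarith
  have hwc : ∀ v, memX v → Tendsto (fun n => innerX v (fun x => u n x - w x)) atTop (𝓝 0) :=
    fun v hv => weak_conv hu hw hv huB hae
  have hwc' : ∀ v, memX v → Tendsto (fun n => innerX v (u n)) atTop (𝓝 (innerX v w)) := fun v hv => by
    have := (hwc v hv).add_const (innerX v w)
    rw [zero_add] at this
    refine this.congr fun n => ?_
    rw [innerX_sub_right hv (hu n) hw]; ring
  have hfw : Integrable (fun x => f (w x)) mu0 := fu_int1 hω0 hTM hcont hfb hw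
  -- the limit is a weak solution
  have hsol : ∀ k : ℕ, innerX w (fun x => trc k (w x)) / (2 * π) = ∫ x, f (w x) * trc k (w x) ∂mu0 := by
    intro k
    have hv := hw.trc k
    have hV : Tendsto (fun n => ∫ x, (f (u n x) - f (w x)) * trc k (w x) ∂mu0) atTop (𝓝 0) :=
      vitali (M := 1) (C := 0) (V := (k : ℝ) + 1) hcont hcont hii one_pos (by positivity) hQ0 (fun t => by simp)
        (fun n => (hu n).meas) hw.meas hv.meas
        (fun x => (trc_abs_le (Nat.cast_nonneg k) _).trans (by linarith)) hae0
        (fun n => hint _ _ (hu n) (hu n)) hQ hfw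
    have h1 : Tendsto (fun n => ∫ x, f (u n x) * trc k (w x) ∂mu0) atTop
        (𝓝 (∫ x, f (w x) * trc k (w x) ∂mu0)) := by
      have := hV.add_const (∫ x, f (w x) * trc k (w x) ∂mu0)
      rw [zero_add] at this
      refine this.congr fun n => ?_
      rw [← integral_add]
      · congr 1; ext x; ring
      · exact ((hint _ _ (hu n) hv).sub (hint _ _ hw hv)).congr
          (Eventually.of_forall fun x => by simp only [Pi.sub_apply]; ring)
      · exact hint _ _ hw hv
    have h2 : Tendsto (fun n => phiDeriv f (u n) (fun x => trc k (w x))) atTop (𝓝 0) := by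
      refine squeeze_zero_norm (fun n => hder n _ hv) ?_
      simpa using hε.mul_const (1 + gagNorm (fun x => trc k (w x)))
    have h3 : Tendsto (fun n => phiDeriv f (u n) (fun x => trc k (w x))) atTop
        (𝓝 (innerX w (fun x => trc k (w x)) / (2 * π) - ∫ x, f (w x) * trc k (w x) ∂mu0)) := by
      unfold phiDeriv
      refine Tendsto.sub (Tendsto.div_const ?_ _) h1
      have := hwc' _ hv
      rw [innerX_comm _ w] at this
      exact this.congr fun n => innerX_comm _ _
    have := tendsto_nhds_unique h2 h3
    linarith
  have hsw := weak_sol hω0 hTM hcont hfb hw hsol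
  have hFw := Fu_int hcont hii hw (hint _ _ hw hw)
  have hφw : 0 ≤ phi f w := by
    have h1 : 2 * ∫ x, primF f (w x) ∂mu0 ≤ ∫ x, f (w x) * w x ∂mu0 := by
      rw [← integral_const_mul]
      exact integral_mono (hFw.const_mul 2) (hint _ _ hw hw) fun x => (F_facts hii (w x)).2.1
    unfold phi
    have e : gagSq w / (4 * π) = gagSq w / (2 * π) / 2 := by field_simp; ring
    rw [e, hsw]
    linarith
  -- convergence of the primitive
  have hFc : Tendsto (fun n => ∫ x, primF f (u n x) ∂mu0) atTop (𝓝 (∫ x, primF f (w x) ∂mu0)) := by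
    have hV : Tendsto (fun n => ∫ x, (primF f (u n x) - primF f (w x)) * (fun _ => (1:ℝ)) x ∂mu0) atTop (𝓝 0) :=
      vitali (M := M) (C := C1) (V := 1) (v := fun _ => (1:ℝ)) hcont (primF_cont hcont) hii hM one_pos hQ0
        (fun t => (hAR t).2)
        (fun n => (hu n).meas) hw.meas measurable_const
        (fun x => by simp) hae0
        (fun n => hint _ _ (hu n) (hu n)) hQ hFw
    have := hV.add_const (∫ x, primF f (w x) ∂mu0)
    rw [zero_add] at this
    refine this.congr fun n => ?_
    simp only [mul_one]
    rw [integral_sub (Fu_int hcont hii (hu n) (hint _ _ (hu n) (hu n))) hFw]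
    ring
  have hgag : Tendsto (fun n => gagSq (u n)) atTop (𝓝 (4 * π * (c + ∫ x, primF f (w x) ∂mu0))) := by
    refine ((hφ.add hFc).const_mul (4 * π)).congr fun n => ?_
    unfold phi
    field_simp
    ring
  have hdiff : Tendsto (fun n => gagSq (fun x => u n x - w x)) atTop (𝓝 (4 * π * (c - phi f w))) := by
    have h1 := (hgag.sub ((hwc' w hw).const_mul 2)).add_const (gagSq w)
    have e : 4 * π * (c + ∫ x, primF f (w x) ∂mu0) - 2 * innerX w w + gagSq w = 4 * π * (c - phi f w) := by
      rw [innerX_self]; unfold phi; field_simp; ring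
    rw [e] at h1
    exact h1.congr fun n => (gagSq_sub' (hu n) hw).symm
  have hlt : 4 * π * (c - phi f w) < 2 * π * ω / α₀ := by
    have : 2 * π * ω / α₀ = 4 * π * (ω / (2 * α₀)) := by field_simp; ring
    rw [this]
    exact mul_lt_mul_of_pos_left (by linarith) (by positivity)
  obtain ⟨ρ, h1ρ, h2ρ⟩ := exists_between (max_lt hlt (show 0 < 2 * π * ω / α₀ by positivity))
  have hρ0 : 0 < ρ := (le_max_right _ _).trans_lt h1ρ
  have hev : ∀ᶠ n in atTop, gagSq (fun x => u n x - w x) ≤ ρ :=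
    hdiff.eventually_le_const ((le_max_left _ _).trans_lt h1ρ)
  have hst := strong_int hω0 hTM hcont hα₀0 hiv2 hu hw hae0 hρ0
    (by rw [lt_div_iff₀ hα₀0] at h2ρ; linarith) hev
  have hNb : ∀ᶠ n in atTop, gagNorm (fun x => u n x - w x) ≤ 1 + ρ := by
    filter_upwards [hev] with n hn
    have h1 := gagNorm_sq (fun x => u n x - w x)
    nlinarith [sq_nonneg (gagNorm (fun x => u n x - w x) - 1)]
  have hpd : Tendsto (fun n => phiDeriv f (u n) (fun x => u n x - w x)) atTop (𝓝 0) := by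
    refine squeeze_zero_norm' (a := fun n => ε n * (1 + (1 + ρ))) ?_ ?_
    · filter_upwards [hNb] with n hn
      exact (hder n _ ((hu n).sub hw)).trans (mul_le_mul_of_nonneg_left (by linarith) (hε1 n))
    · simpa using hε.mul_const (1 + (1 + ρ))
  have hin : Tendsto (fun n => innerX (u n) (fun x => u n x - w x)) atTop (𝓝 0) := by
    have := (hpd.add hst).const_mul (2 * π)
    simp only [add_zero, mul_zero] at this
    refine this.congr fun n => ?_
    unfold phiDeriv
    field_simp
    ring
  have hfin : Tendsto (fun n => gagSq (fun x => u n x - w x)) atTop (𝓝 0) := by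
    have := hin.sub (hwc w hw)
    rw [sub_zero] at this
    exact this.congr fun n => (gagSq_sub (hu n) hw).symm
  have := (Real.continuous_sqrt.tendsto 0).comp hfin
  rw [Real.sqrt_zero] at this
  exact this


/-- Palais–Smale condition below the level `ω/(2α₀)` in the
critical case (Lemma 4.1). -/
theorem statement11 (ω : ℝ) (hω0 : 0 < ω) (hωπ : ω ≤ π) (hTM : TMprop ω)
    (f : ℝ → ℝ) (hcont : Continuous f) (hf0 : f 0 = 0)
    (hi : ∃ t₀ > (0 : ℝ), ∃ M > (0 : ℝ),
      ∀ t : ℝ, t₀ ≤ |t| → 0 < primF f t ∧ primF f t ≤ M * |f t|)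
    (hii : ∀ t : ℝ, t ≠ 0 → 0 < 2 * primF f t ∧ 2 * primF f t ≤ f t * t)
    (hiii : Filter.limsup (fun t => primF f t / t ^ 2) (𝓝[≠] (0 : ℝ)) < lam1 / (4 * π))
    (α₀ : ℝ) (hα₀0 : 0 < α₀) (hα₀ : α₀ < 2 * π * ω)
    (hiv1 : ∀ α : ℝ, 0 < α → α < α₀ →
      Filter.Tendsto (fun t => |f t| * exp (-α * t ^ 2)) (Filter.cocompact ℝ) Filter.atTop)
    (hiv2 : ∀ α : ℝ, α₀ < α →
      Filter.Tendsto (fun t => |f t| * exp (-α * t ^ 2)) (Filter.cocompact ℝ) (𝓝 0)) :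
    ∀ c : ℝ, c < ω / (2 * α₀) → PalaisSmaleAt f c := by
  exact main_aux ω hω0 hTM f hcont hi hii α₀ hα₀0 hiv2
end
end

section
/- Let f : ℝ → ℝ be continuous with F(t) = ∫₀^t f(τ) dτ, and suppose there exist t₀, M > 0 such that 0 < F(t) ≤ M|f(t)| for all |t| ≥ t₀ and 0 < 2F(t) ≤ f(t)t for all t ≠ 0. Then there exists c₃ > 0 such that F(t) ≥ c₃ e^{|t|/M} for all |t| ≥ t₀. -/
open MeasureTheory Real Set Filter Topology

noncomputable section

theorem exp_growth_aux (G g : ℝ → ℝ) (t₀ M : ℝ) (hM : 0 < M)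
    (hd : ∀ t, HasDerivAt G (g t) t) (hg : ∀ t, t₀ ≤ t → G t ≤ M * g t) (t : ℝ) (ht : t₀ ≤ t) :
    G t₀ * exp (-t₀ / M) * exp (t / M) ≤ G t := by
  have hD : ∀ x, HasDerivAt (fun x => G x * exp (-x / M))
      (g x * exp (-x / M) + G x * (exp (-x / M) * (-1 / M))) x := fun x =>
    (hd x).mul (((hasDerivAt_id x).neg.div_const M).exp)
  have hmono : MonotoneOn (fun x => G x * exp (-x / M)) (Set.Ici t₀) := by
    apply monotoneOn_of_deriv_nonneg (convex_Ici t₀)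
    · exact fun x _ => (hD x).continuousAt.continuousWithinAt
    · exact fun x _ => (hD x).differentiableAt.differentiableWithinAt
    · intro x hx
      rw [interior_Ici] at hx
      rw [(hD x).deriv]
      have h := hg x (le_of_lt hx)
      have e : g x * exp (-x / M) + G x * (exp (-x / M) * (-1 / M))
          = (M * g x - G x) / M * exp (-x / M) := by
        field_simp
        ring
      rw [e]
      exact mul_nonneg (div_nonneg (by linarith) hM.le) (exp_pos _).le
  have h := hmono (Set.mem_Ici.2 le_rfl) (Set.mem_Ici.2 ht) ht
  simp only at h
  calc G t₀ * exp (-t₀ / M) * exp (t / M) ≤ G t * exp (-t / M) * exp (t / M) :=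
        mul_le_mul_of_nonneg_right h (exp_pos _).le
    _ = G t := by
        rw [mul_assoc, ← Real.exp_add, neg_div, neg_add_cancel, Real.exp_zero, mul_one]

/-- exponential lower bound for `F` (inequality (3.2)). -/
theorem statement14 (f : ℝ → ℝ) (hf : Continuous f)
    (t₀ M : ℝ) (ht₀ : 0 < t₀) (hM : 0 < M)
    (h1 : ∀ t : ℝ, t₀ ≤ |t| → 0 < primF f t ∧ primF f t ≤ M * |f t|)
    (h2 : ∀ t : ℝ, t ≠ 0 → 0 < 2 * primF f t ∧ 2 * primF f t ≤ f t * t) :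
    ∃ c₃ : ℝ, 0 < c₃ ∧ ∀ t : ℝ, t₀ ≤ |t| → c₃ * exp (|t| / M) ≤ primF f t := by
  have hd : ∀ t, HasDerivAt (primF f) (f t) t := fun t =>
    intervalIntegral.integral_hasDerivAt_right (hf.intervalIntegrable _ _)
      hf.stronglyMeasurable.stronglyMeasurableAtFilter hf.continuousAt
  have hd' : ∀ t, HasDerivAt (fun t => primF f (-t)) (-f (-t)) t := fun t => by
    have h := (hd (-t)).comp t (hasDerivAt_neg t)
    simpa [Function.comp_def] using h
  have k1 := exp_growth_aux (primF f) f t₀ M hM hd (fun t ht => by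
    have hp : 0 < t := by linarith
    have a := (h1 t (by rwa [abs_of_pos hp])).2
    have b := h2 t hp.ne'
    have : 0 < f t := pos_of_mul_pos_left (by linarith [b.1, b.2]) hp.le
    rwa [abs_of_pos this] at a)
  have k2 := exp_growth_aux (fun t => primF f (-t)) (fun t => -f (-t)) t₀ M hM hd' (fun t ht => by
    have hp : 0 < t := by linarith
    have a := (h1 (-t) (by rwa [abs_neg, abs_of_pos hp])).2
    have b := h2 (-t) (neg_ne_zero.2 hp.ne')
    have : 0 < -f (-t) := pos_of_mul_pos_left (b := t) (by linarith [b.1, b.2]) hp.le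
    rwa [abs_of_neg (by linarith)] at a)
  have p1 := (h1 t₀ (le_abs_self _)).1
  have p2 := (h1 (-t₀) (by rw [abs_neg]; exact le_abs_self _)).1
  refine ⟨min (primF f t₀) (primF f (-t₀)) * exp (-t₀ / M), by positivity, fun t ht => ?_⟩
  rcases le_total 0 t with h | h
  · rw [abs_of_nonneg h] at ht ⊢
    refine le_trans ?_ (k1 t ht)
    gcongr
    exact min_le_left _ _
  · rw [abs_of_nonpos h] at ht ⊢
    have := k2 (-t) ht
    simp only [neg_neg] at this
    refine le_trans ?_ this
    gcongr
    exact min_le_right _ _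
end
end
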